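/- arXiv:2205.01375 — 4 statements merged into one kernel-verified Lean document; each statement's English description precedes it below -/
import Mathlib

section
/- Let ν, κ, γ, a, b, 𝒞 be positive real constants and let 0 < r < R. There is a constant C > 0 (depending only on r, R and the parameters) with the following property: if ϱ ∈ [r, R], F : [0, ∞) → ℂ⁴ is continuous, and U : [0, ∞) → ℂ⁴ is differentiable with U′(t) + A(ϱ)·U(t) = F(t) for all t ≥ 0, then for every t ≥ 0 one has ∫₀ᵗ ‖U(τ)‖² dτ ≤ C·( ‖U(0)‖² + ∫₀ᵗ ‖F(τ)‖² dτ ). -/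
open Matrix MeasureTheory

/-- The symbol matrix `A(ϱ)` of the linearized diffusion-approximation radiation
hydrodynamics system in Fourier variables. -/
noncomputable def radA (ν κ γ a b 𝒞 ϱ : ℝ) : Matrix (Fin 4) (Fin 4) ℝ :=
  !![0, ϱ, 0, 0;
     -ϱ, ν * ϱ ^ 2, -ϱ, -ϱ / (3 * 𝒞);
     0, (2 / 3) * ϱ, (2 / 3) * κ * ϱ ^ 2 + (2 / 3) * γ, -(2 / 3) * b;
     0, 0, -𝒞 * γ, a * ϱ ^ 2 + 𝒞 * b]


lemma quad_lower (p q s x y : ℝ) (h : 0 < p + s) :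
    (4 * p * s - q ^ 2) / (4 * (p + s)) * (x ^ 2 + y ^ 2) ≤ p * x ^ 2 + q * x * y + s * y ^ 2 := by
  rw [div_mul_eq_mul_div, div_le_iff₀ (by linarith)]
  nlinarith [sq_nonneg (2 * p * x + q * y), sq_nonneg (2 * s * y + q * x)]

lemma stage1 (κ γ a b c r R : ℝ)
    (hκ : 0 < κ) (hγ : 0 < γ) (ha : 0 < a) (hb : 0 < b) (hc : 0 < c)
    (hr : 0 < r) (hrR : r < R) :
    ∃ c0 W : ℝ, 0 < c0 ∧ 0 < W ∧ ∀ ϱ : ℝ, r ≤ ϱ → ϱ ≤ R → ∃ w : ℝ,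
      1 / (3 * c ^ 2) ≤ w ∧ w ≤ W ∧ ∀ θ j : ℝ,
        c0 * (θ ^ 2 + j ^ 2) ≤
          (3 / 2 * θ + j / (2 * c)) * (((2 / 3) * κ * ϱ ^ 2 + (2 / 3) * γ) * θ + (-(2 / 3) * b) * j)
          + (θ / (2 * c) + w * j) * (-c * γ * θ + (a * ϱ ^ 2 + c * b) * j) := by
  let L : ℝ → ℝ := fun ϱ => (2 + 4 * κ * ϱ ^ 2 / γ) * (b + a * ϱ ^ 2 / c)
  let h : ℝ → ℝ := fun ϱ => b / 2 - (κ / (3 * c) + a / (2 * c)) * ϱ ^ 2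
  let y : ℝ → ℝ := fun ϱ => (L ϱ / 2 - h ϱ) / γ
  let w : ℝ → ℝ := fun ϱ => (1 / (3 * c) + y ϱ) / c
  let p : ℝ → ℝ := fun ϱ => κ * ϱ ^ 2 + γ / 2
  let s : ℝ → ℝ := fun ϱ => (b + a * ϱ ^ 2 / c) * y ϱ + a * ϱ ^ 2 / (3 * c ^ 2)
  let q : ℝ → ℝ := fun ϱ => - (L ϱ / 2)
  let k : ℝ → ℝ := fun ϱ => (4 * p ϱ * s ϱ - q ϱ ^ 2) / (4 * (p ϱ + s ϱ))
  have hL : ∀ ϱ, 2 * b ≤ L ϱ := by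
    intro ϱ
    have h1 : 0 ≤ 4 * κ * ϱ ^ 2 / γ := by positivity
    have h2 : 0 ≤ a * ϱ ^ 2 / c := by positivity
    simp only [L]
    nlinarith [mul_nonneg h1 h2, mul_nonneg h1 hb.le]
  have hh : ∀ ϱ, h ϱ ≤ b / 2 := by
    intro ϱ
    have : 0 ≤ (κ / (3 * c) + a / (2 * c)) * ϱ ^ 2 := by positivity
    simp only [h]; linarith
  have hy : ∀ ϱ, 0 < y ϱ := by
    intro ϱ
    apply div_pos _ hγ
    linarith [hL ϱ, hh ϱ]
  have hp : ∀ ϱ, 0 < p ϱ := fun ϱ => by simp only [p]; positivity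
  have hs : ∀ ϱ, 0 < s ϱ := fun ϱ => by
    have := hy ϱ
    simp only [s]; positivity
  have hdisc : ∀ ϱ, 0 < ϱ → 0 < 4 * p ϱ * s ϱ - q ϱ ^ 2 := by
    intro ϱ hϱ
    have e : 4 * p ϱ * s ϱ - q ϱ ^ 2 = L ϱ * (L ϱ / 4 - h ϱ)
        + 4 * (κ * ϱ ^ 2 + γ / 2) * (a * ϱ ^ 2 / (3 * c ^ 2)) := by
      have e1 : 4 * p ϱ * (b + a * ϱ ^ 2 / c) = γ * L ϱ := by
        simp only [p, L]; field_simp; ring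
      have e2 : γ * y ϱ = L ϱ / 2 - h ϱ := by
        simp only [y]; field_simp
      have e3 : 4 * p ϱ * s ϱ = (4 * p ϱ * (b + a * ϱ ^ 2 / c)) * y ϱ
         + 4 * (κ * ϱ ^ 2 + γ / 2) * (a * ϱ ^ 2 / (3 * c ^ 2)) := by
        simp only [s, p]; ring
      rw [e3, e1]
      simp only [q]
      linear_combination (L ϱ) * e2
    rw [e]
    have h1 : 0 ≤ L ϱ * (L ϱ / 4 - h ϱ) :=
      mul_nonneg (by linarith [hL ϱ]) (by linarith [hL ϱ, hh ϱ])
    have h2 : 0 < 4 * (κ * ϱ ^ 2 + γ / 2) * (a * ϱ ^ 2 / (3 * c ^ 2)) := by positivity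
    linarith
  have cL : Continuous L := by simp only [L]; fun_prop
  have ch : Continuous h := by simp only [h]; fun_prop
  have cy : Continuous y := by simp only [y]; fun_prop
  have cw : Continuous w := by simp only [w]; fun_prop
  have cp : Continuous p := by simp only [p]; fun_prop
  have cs : Continuous s := by simp only [s]; fun_prop
  have cq : Continuous q := by simp only [q]; fun_prop
  have ck : Continuous k := by
    simp only [k]
    apply Continuous.div (by fun_prop) (by fun_prop)
    intro x
    have := hp x; have := hs x; positivity
  have hne : (Set.Icc r R).Nonempty := ⟨r, le_refl _, hrR.le⟩
  obtain ⟨x0, hx0, hmin⟩ := isCompact_Icc.exists_isMinOn hne ck.continuousOn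
  obtain ⟨x1, hx1, hmax⟩ := isCompact_Icc.exists_isMaxOn hne cw.continuousOn
  refine ⟨k x0, w x1, ?_, ?_, ?_⟩
  · have := hp x0; have := hs x0
    exact div_pos (hdisc x0 (hr.trans_le hx0.1)) (by positivity)
  · have := hy x1
    simp only [w]; positivity
  · intro ϱ h1 h2
    refine ⟨w ϱ, ?_, hmax ⟨h1, h2⟩, ?_⟩
    · have e : w ϱ = 1 / (3 * c ^ 2) + y ϱ / c := by simp only [w]; field_simp
      have := div_pos (hy ϱ) hc
      linarith
    · intro θ j
      have hk : k x0 ≤ k ϱ := hmin ⟨h1, h2⟩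
      have := quad_lower (p ϱ) (q ϱ) (s ϱ) θ j (add_pos (hp ϱ) (hs ϱ))
      have h3 : k x0 * (θ ^ 2 + j ^ 2) ≤ k ϱ * (θ ^ 2 + j ^ 2) := by gcongr
      refine h3.trans (this.trans (le_of_eq ?_))
      have e2 : γ * y ϱ = L ϱ / 2 - h ϱ := by
        simp only [y]; field_simp
      have e3 : q ϱ = - (γ * y ϱ + h ϱ) := by rw [e2]; simp only [q]; ring
      rw [e3]
      simp only [p, s, w, h]
      field_simp
      ring

lemma young (x y d : ℝ) (hd : 0 < d) : x * y ≤ d * x ^ 2 + y ^ 2 / (4 * d) := by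
  have : d * x ^ 2 + y ^ 2 / (4 * d) - x * y = (2 * d * x - y) ^ 2 / (4 * d) := by
    field_simp; ring
  have h2 : 0 ≤ (2 * d * x - y) ^ 2 / (4 * d) := by positivity
  linarith

lemma stage2 (ν κ γ a b c r R : ℝ) (hν : 0 < ν)
    (hκ : 0 < κ) (hγ : 0 < γ) (ha : 0 < a) (hb : 0 < b) (hc : 0 < c)
    (hr : 0 < r) (hrR : r < R) :
    ∃ d W ε : ℝ, 0 < d ∧ 0 < W ∧ 0 < ε ∧ ε ≤ 1 / 2 ∧ ∀ ϱ : ℝ, r ≤ ϱ → ϱ ≤ R → ∃ w : ℝ,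
      1 / (3 * c ^ 2) ≤ w ∧ w ≤ W ∧ ∀ n u θ j : ℝ,
        d * (n ^ 2 + u ^ 2 + θ ^ 2 + j ^ 2) ≤
          (n - ε * u) * (ϱ * u)
          + (u - ε * n) * (-ϱ * n + ν * ϱ ^ 2 * u + -ϱ * θ + -ϱ / (3 * c) * j)
          + (3 / 2 * θ + j / (2 * c)) *
            ((2 / 3) * ϱ * u + ((2 / 3) * κ * ϱ ^ 2 + (2 / 3) * γ) * θ + (-(2 / 3) * b) * j)
          + (θ / (2 * c) + w * j) * (-c * γ * θ + (a * ϱ ^ 2 + c * b) * j) := by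
  obtain ⟨c0, W, hc0, hW, H⟩ := stage1 κ γ a b c r R hκ hγ ha hb hc hr hrR
  have hR : 0 < R := hr.trans hrR
  set c1 := min c0 (ν * r ^ 2) with hc1
  have hc1p : 0 < c1 := lt_min hc0 (by positivity)
  set K := R + 3 / (2 * r) * (ν ^ 2 * R ^ 4 + R ^ 2 + R ^ 2 * (1 / (3 * c)) ^ 2) with hK
  have hKp : 0 < K := by positivity
  set ε := min (1 / 2) (c1 / (2 * K)) with hε
  have hεp : 0 < ε := lt_min (by norm_num) (by positivity)
  have hεK : ε * K ≤ c1 / 2 := by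
    have : ε ≤ c1 / (2 * K) := min_le_right _ _
    rw [le_div_iff₀ (by positivity)] at this
    linarith
  refine ⟨min (c1 / 2) (ε * (r / 2)), W, ε, lt_min (by positivity) (by positivity), hW, hεp,
    min_le_left _ _, ?_⟩
  intro ϱ h1 h2
  obtain ⟨w, hw1, hw2, hw⟩ := H ϱ h1 h2
  refine ⟨w, hw1, hw2, ?_⟩
  intro n u θ j
  have hϱ : 0 < ϱ := hr.trans_le h1
  have hw' := hw θ j
  have A1 : c1 * (u ^ 2 + θ ^ 2 + j ^ 2) ≤ ν * ϱ ^ 2 * u ^ 2 + c0 * (θ ^ 2 + j ^ 2) := by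
    have i1 : c1 ≤ c0 := min_le_left _ _
    have i2 : c1 ≤ ν * ϱ ^ 2 := (min_le_right _ _).trans (by gcongr)
    have := mul_le_mul_of_nonneg_right i1 (by positivity : 0 ≤ θ ^ 2 + j ^ 2)
    have := mul_le_mul_of_nonneg_right i2 (sq_nonneg u)
    linarith
  set e := 1 / (3 * c) with he
  set g := ν * ϱ ^ 2 * u - ϱ * θ - ϱ * e * j with hg
  have A2 : g ^ 2 ≤ 3 * ((ν ^ 2 * R ^ 4 + R ^ 2 + R ^ 2 * e ^ 2) * (u ^ 2 + θ ^ 2 + j ^ 2)) := by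
    have s0 : g ^ 2 ≤ 3 * ((ν * ϱ ^ 2 * u) ^ 2 + (ϱ * θ) ^ 2 + (ϱ * e * j) ^ 2) := by
      rw [hg]
      nlinarith [sq_nonneg (ν * ϱ ^ 2 * u + ϱ * θ), sq_nonneg (ν * ϱ ^ 2 * u + ϱ * e * j),
        sq_nonneg (ϱ * θ - ϱ * e * j)]
    have s1 : (ν * ϱ ^ 2 * u) ^ 2 ≤ ν ^ 2 * R ^ 4 * u ^ 2 := by
      have : (ν * ϱ ^ 2 * u) ^ 2 = ν ^ 2 * ϱ ^ 4 * u ^ 2 := by ring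
      rw [this]; gcongr
    have s2 : (ϱ * θ) ^ 2 ≤ R ^ 2 * θ ^ 2 := by rw [mul_pow]; gcongr
    have s3 : (ϱ * e * j) ^ 2 ≤ R ^ 2 * e ^ 2 * j ^ 2 := by rw [mul_pow, mul_pow]; gcongr
    have t1 : 0 ≤ ν ^ 2 * R ^ 4 * (θ ^ 2 + j ^ 2) := by positivity
    have t2 : 0 ≤ R ^ 2 * (u ^ 2 + j ^ 2) := by positivity
    have t3 : 0 ≤ R ^ 2 * e ^ 2 * (u ^ 2 + θ ^ 2) := by positivity
    linarith
  have A3 : n * g ≤ r / 2 * n ^ 2 + g ^ 2 / (2 * r) := by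
    have := young n g (r / 2) (by positivity)
    rwa [show 4 * (r / 2) = 2 * r by ring] at this
  have A4 : g ^ 2 / (2 * r) ≤
      3 / (2 * r) * (ν ^ 2 * R ^ 4 + R ^ 2 + R ^ 2 * e ^ 2) * (u ^ 2 + θ ^ 2 + j ^ 2) := by
    rw [div_le_iff₀ (by positivity)]
    refine A2.trans (le_of_eq ?_)
    field_simp
  have A5 : r / 2 * n ^ 2 - K * (u ^ 2 + θ ^ 2 + j ^ 2) ≤ ϱ * n ^ 2 - ϱ * u ^ 2 - n * g := by
    have t1 : r * n ^ 2 ≤ ϱ * n ^ 2 := by gcongr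
    have t2 : ϱ * u ^ 2 ≤ R * u ^ 2 := by gcongr
    have t3 : 0 ≤ R * (θ ^ 2 + j ^ 2) := by positivity
    rw [hK]
    linarith
  have A6 := mul_le_mul_of_nonneg_left A5 hεp.le
  have A7 := mul_le_mul_of_nonneg_right hεK (by positivity : 0 ≤ u ^ 2 + θ ^ 2 + j ^ 2)
  have A8 : min (c1 / 2) (ε * (r / 2)) * (n ^ 2 + u ^ 2 + θ ^ 2 + j ^ 2) ≤
      c1 / 2 * (u ^ 2 + θ ^ 2 + j ^ 2) + ε * (r / 2) * n ^ 2 := by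
    have := mul_le_mul_of_nonneg_right (min_le_left (c1 / 2) (ε * (r / 2)))
      (by positivity : 0 ≤ u ^ 2 + θ ^ 2 + j ^ 2)
    have := mul_le_mul_of_nonneg_right (min_le_right (c1 / 2) (ε * (r / 2))) (sq_nonneg n)
    linarith
  have key : (n - ε * u) * (ϱ * u)
          + (u - ε * n) * (-ϱ * n + ν * ϱ ^ 2 * u + -ϱ * θ + -ϱ / (3 * c) * j)
          + (3 / 2 * θ + j / (2 * c)) *
            ((2 / 3) * ϱ * u + ((2 / 3) * κ * ϱ ^ 2 + (2 / 3) * γ) * θ + (-(2 / 3) * b) * j)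
          + (θ / (2 * c) + w * j) * (-c * γ * θ + (a * ϱ ^ 2 + c * b) * j)
      = ν * ϱ ^ 2 * u ^ 2 + ((3 / 2 * θ + j / (2 * c)) *
          (((2 / 3) * κ * ϱ ^ 2 + (2 / 3) * γ) * θ + (-(2 / 3) * b) * j)
          + (θ / (2 * c) + w * j) * (-c * γ * θ + (a * ϱ ^ 2 + c * b) * j))
        + ε * (ϱ * n ^ 2 - ϱ * u ^ 2 - n * g) := by
    rw [hg, he]
    field_simp
    ring
  rw [key]
  linarith

set_option maxHeartbeats 1000000 in
lemma stage3 (ν κ γ a b c r R : ℝ) (hν : 0 < ν)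
    (hκ : 0 < κ) (hγ : 0 < γ) (ha : 0 < a) (hb : 0 < b) (hc : 0 < c)
    (hr : 0 < r) (hrR : r < R) :
    ∃ d K : ℝ, 0 < d ∧ 0 < K ∧ ∀ ϱ : ℝ, r ≤ ϱ → ϱ ≤ R → ∃ w ε : ℝ,
      (∀ n u θ j : ℝ,
        0 ≤ (n ^ 2 + u ^ 2 + 3 / 2 * θ ^ 2 + θ * j / c + w * j ^ 2) / 2 - ε * n * u ∧
        (n ^ 2 + u ^ 2 + 3 / 2 * θ ^ 2 + θ * j / c + w * j ^ 2) / 2 - ε * n * u ≤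
          K * (n ^ 2 + u ^ 2 + θ ^ 2 + j ^ 2)) ∧
      ∀ n u θ j f1 f2 f3 f4 : ℝ,
          (n - ε * u) * (f1 - (ϱ * u))
          + (u - ε * n) * (f2 - (-ϱ * n + ν * ϱ ^ 2 * u + -ϱ * θ + -ϱ / (3 * c) * j))
          + (3 / 2 * θ + j / (2 * c)) * (f3 -
            ((2 / 3) * ϱ * u + ((2 / 3) * κ * ϱ ^ 2 + (2 / 3) * γ) * θ + (-(2 / 3) * b) * j))
          + (θ / (2 * c) + w * j) * (f4 - (-c * γ * θ + (a * ϱ ^ 2 + c * b) * j)) ≤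
          K * (f1 ^ 2 + f2 ^ 2 + f3 ^ 2 + f4 ^ 2) - d * (n ^ 2 + u ^ 2 + θ ^ 2 + j ^ 2) := by
  obtain ⟨d, W, ε, hd, hW, hε, hε2, H⟩ := stage2 ν κ γ a b c r R hν hκ hγ ha hb hc hr hrR
  set e := 1 / (2 * c) with he
  have hep : 0 < e := by positivity
  set M := 5 + 2 * e ^ 2 + 2 * W ^ 2 + (5 / 2 + 2 * e ^ 2) with hM
  have hMp : 0 < M := by positivity
  set δ := d / (2 * M) with hδ
  have hδp : 0 < δ := by positivity
  refine ⟨d / 2, 1 / (4 * δ) + (2 + e + W), by positivity, by positivity, ?_⟩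
  intro ϱ h1 h2
  obtain ⟨w, hw1, hw2, hw⟩ := H ϱ h1 h2
  have hw0 : 0 < w := lt_of_lt_of_le (by positivity) hw1
  refine ⟨w, ε, ?_, ?_⟩
  · intro n u θ j
    have e1 : θ * j / c = 2 * e * (θ * j) := by rw [he]; field_simp
    have e2 : 4 / 3 * e ^ 2 ≤ w := by
      refine le_trans (le_of_eq ?_) hw1
      rw [he]; field_simp; norm_num
    rw [e1]
    have nu1 : 0 ≤ ε * (n - u) ^ 2 := by positivity
    have nu2 : 0 ≤ ε * (n + u) ^ 2 := by positivity
    have nu3 : 0 ≤ (1 / 2 - ε) * (n ^ 2 + u ^ 2) := mul_nonneg (by linarith) (by positivity)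
    constructor
    · have := mul_le_mul_of_nonneg_right e2 (sq_nonneg j)
      linarith [sq_nonneg (e * j), sq_nonneg (3 * θ + 2 * e * j),
        sq_nonneg n, sq_nonneg u]
    · have q1 := mul_le_mul_of_nonneg_right hw2 (sq_nonneg j)
      have q2 : 0 ≤ e * (θ - j) ^ 2 := by positivity
      have q3 : 0 ≤ 1 / (4 * δ) * (n ^ 2 + u ^ 2 + θ ^ 2 + j ^ 2) := by positivity
      have q4 : 0 ≤ W * (n ^ 2 + u ^ 2 + θ ^ 2) := by positivity
      have q5 : 0 ≤ e * (n ^ 2 + u ^ 2) := by positivity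
      have q6 : 0 ≤ e * (θ ^ 2 + j ^ 2) := by positivity
      have q7 : 0 ≤ W * j ^ 2 := by positivity
      linarith [sq_nonneg n, sq_nonneg u, sq_nonneg θ, sq_nonneg j]
  · intro n u θ j f1 f2 f3 f4
    have hD := hw n u θ j
    have y1 := young (n - ε * u) f1 δ hδp
    have y2 := young (u - ε * n) f2 δ hδp
    have y3 := young (3 / 2 * θ + j / (2 * c)) f3 δ hδp
    have y4 := young (θ / (2 * c) + w * j) f4 δ hδp
    have ee : ε ^ 2 ≤ 1 / 4 := by
      have := pow_le_pow_left₀ hε.le hε2 2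
      norm_num at this ⊢
      exact this
    have ww : w ^ 2 ≤ W ^ 2 := by gcongr
    have z1 : (n - ε * u) ^ 2 ≤ 2 * n ^ 2 + 1 / 2 * u ^ 2 := by
      linarith [sq_nonneg (n + ε * u), mul_le_mul_of_nonneg_right ee (sq_nonneg u)]
    have z2 : (u - ε * n) ^ 2 ≤ 2 * u ^ 2 + 1 / 2 * n ^ 2 := by
      linarith [sq_nonneg (u + ε * n), mul_le_mul_of_nonneg_right ee (sq_nonneg n)]
    have z3 : (3 / 2 * θ + j / (2 * c)) ^ 2 ≤ 5 * θ ^ 2 + 2 * e ^ 2 * j ^ 2 := by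
      have : j / (2 * c) = e * j := by rw [he]; field_simp
      rw [this]
      linarith [sq_nonneg (3 / 2 * θ - e * j), sq_nonneg θ]
    have z4 : (θ / (2 * c) + w * j) ^ 2 ≤ 2 * e ^ 2 * θ ^ 2 + 2 * W ^ 2 * j ^ 2 := by
      have : θ / (2 * c) = e * θ := by rw [he]; field_simp
      rw [this]
      linarith [sq_nonneg (e * θ - w * j), mul_le_mul_of_nonneg_right ww (sq_nonneg j)]
    have z5 : (n - ε * u) ^ 2 + (u - ε * n) ^ 2 + (3 / 2 * θ + j / (2 * c)) ^ 2
        + (θ / (2 * c) + w * j) ^ 2 ≤ M * (n ^ 2 + u ^ 2 + θ ^ 2 + j ^ 2) := by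
      have t1 : 0 ≤ e ^ 2 * (n ^ 2 + u ^ 2 + θ ^ 2 + j ^ 2) := by positivity
      have t2 : 0 ≤ W ^ 2 * (n ^ 2 + u ^ 2 + θ ^ 2) := by positivity
      have t3 : 0 ≤ e ^ 2 * (n ^ 2 + u ^ 2 + θ ^ 2) := by positivity
      have t4 : 0 ≤ e ^ 2 * (n ^ 2 + u ^ 2 + j ^ 2) := by positivity
      rw [hM]
      linarith [sq_nonneg n, sq_nonneg u, sq_nonneg θ, sq_nonneg j]
    have z6 := mul_le_mul_of_nonneg_left z5 hδp.le
    have z7 : δ * (M * (n ^ 2 + u ^ 2 + θ ^ 2 + j ^ 2)) =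
        d / 2 * (n ^ 2 + u ^ 2 + θ ^ 2 + j ^ 2) := by
      rw [hδ]; field_simp
    have z8 : 0 ≤ (2 + e + W) * (f1 ^ 2 + f2 ^ 2 + f3 ^ 2 + f4 ^ 2) := by positivity
    have z9 : f1 ^ 2 / (4 * δ) + f2 ^ 2 / (4 * δ) + f3 ^ 2 / (4 * δ) + f4 ^ 2 / (4 * δ) =
      1 / (4 * δ) * (f1 ^ 2 + f2 ^ 2 + f3 ^ 2 + f4 ^ 2) := by ring
    linarith

lemma stage4 (ν κ γ a b c r R : ℝ) (hν : 0 < ν)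
    (hκ : 0 < κ) (hγ : 0 < γ) (ha : 0 < a) (hb : 0 < b) (hc : 0 < c)
    (hr : 0 < r) (hrR : r < R) :
    ∃ C : ℝ, 0 < C ∧ ∀ ϱ : ℝ, r ≤ ϱ → ϱ ≤ R →
      ∀ n u θ j f1 f2 f3 f4 : ℝ → ℝ,
      ContinuousOn f1 (Set.Ici 0) → ContinuousOn f2 (Set.Ici 0) →
      ContinuousOn f3 (Set.Ici 0) → ContinuousOn f4 (Set.Ici 0) →
      (∀ t ∈ Set.Ici (0 : ℝ), HasDerivWithinAt n (f1 t - (ϱ * u t)) (Set.Ici 0) t) →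
      (∀ t ∈ Set.Ici (0 : ℝ), HasDerivWithinAt u
        (f2 t - (-ϱ * n t + ν * ϱ ^ 2 * u t + -ϱ * θ t + -ϱ / (3 * c) * j t)) (Set.Ici 0) t) →
      (∀ t ∈ Set.Ici (0 : ℝ), HasDerivWithinAt θ
        (f3 t - ((2 / 3) * ϱ * u t + ((2 / 3) * κ * ϱ ^ 2 + (2 / 3) * γ) * θ t
          + (-(2 / 3) * b) * j t)) (Set.Ici 0) t) →
      (∀ t ∈ Set.Ici (0 : ℝ), HasDerivWithinAt j
        (f4 t - (-c * γ * θ t + (a * ϱ ^ 2 + c * b) * j t)) (Set.Ici 0) t) →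
      ∀ t : ℝ, 0 ≤ t →
        (∫ τ in (0 : ℝ)..t, (n τ ^ 2 + u τ ^ 2 + θ τ ^ 2 + j τ ^ 2)) ≤
          C * ((n 0 ^ 2 + u 0 ^ 2 + θ 0 ^ 2 + j 0 ^ 2)
            + ∫ τ in (0 : ℝ)..t, (f1 τ ^ 2 + f2 τ ^ 2 + f3 τ ^ 2 + f4 τ ^ 2)) := by
  obtain ⟨d, K, hd, hK, H⟩ := stage3 ν κ γ a b c r R hν hκ hγ ha hb hc hr hrR
  refine ⟨K / d, by positivity, ?_⟩
  intro ϱ h1 h2 n u θ j f1 f2 f3 f4 cf1 cf2 cf3 cf4 dn du dθ dj t ht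
  obtain ⟨w, ε, HE, HD⟩ := H ϱ h1 h2
  have cn : ContinuousOn n (Set.Ici 0) := fun x hx => (dn x hx).continuousWithinAt
  have cu : ContinuousOn u (Set.Ici 0) := fun x hx => (du x hx).continuousWithinAt
  have cθ : ContinuousOn θ (Set.Ici 0) := fun x hx => (dθ x hx).continuousWithinAt
  have cj : ContinuousOn j (Set.Ici 0) := fun x hx => (dj x hx).continuousWithinAt
  have sub : Set.uIcc 0 t ⊆ Set.Ici 0 := by
    rw [Set.uIcc_of_le ht]; exact Set.Icc_subset_Ici_self
  have cX : ContinuousOn (fun τ => n τ ^ 2 + u τ ^ 2 + θ τ ^ 2 + j τ ^ 2) (Set.Ici 0) := by fun_prop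
  have cG : ContinuousOn (fun τ => f1 τ ^ 2 + f2 τ ^ 2 + f3 τ ^ 2 + f4 τ ^ 2) (Set.Ici 0) := by
    fun_prop
  have iX := (cX.mono sub).intervalIntegrable (μ := volume)
  have iG := (cG.mono sub).intervalIntegrable (μ := volume)
  let E : ℝ → ℝ := fun τ =>
    (n τ ^ 2 + u τ ^ 2 + 3 / 2 * θ τ ^ 2 + θ τ * j τ / c + w * j τ ^ 2) / 2 - ε * n τ * u τ
  have cE : ContinuousOn E (Set.Ici 0) := by simp only [E]; fun_prop
  have mono := intervalIntegral.sub_le_integral_of_hasDeriv_right_of_le (g := E) (a := 0) (b := t)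
    (g' := fun τ => (n τ - ε * u τ) * (f1 τ - (ϱ * u τ))
          + (u τ - ε * n τ) * (f2 τ - (-ϱ * n τ + ν * ϱ ^ 2 * u τ + -ϱ * θ τ + -ϱ / (3 * c) * j τ))
          + (3 / 2 * θ τ + j τ / (2 * c)) * (f3 τ -
            ((2 / 3) * ϱ * u τ + ((2 / 3) * κ * ϱ ^ 2 + (2 / 3) * γ) * θ τ + (-(2 / 3) * b) * j τ))
          + (θ τ / (2 * c) + w * j τ) * (f4 τ - (-c * γ * θ τ + (a * ϱ ^ 2 + c * b) * j τ)))
    (φ := fun τ => K * (f1 τ ^ 2 + f2 τ ^ 2 + f3 τ ^ 2 + f4 τ ^ 2)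
      - d * (n τ ^ 2 + u τ ^ 2 + θ τ ^ 2 + j τ ^ 2)) ht (cE.mono Set.Icc_subset_Ici_self)
    (by
      intro x hx
      have hx0 : x ∈ Set.Ici (0 : ℝ) := hx.1.le
      have ss : Set.Ioi x ⊆ Set.Ici 0 := fun z hz => hx.1.le.trans (le_of_lt hz)
      have a1 := (dn x hx0).mono ss
      have a2 := (du x hx0).mono ss
      have a3 := (dθ x hx0).mono ss
      have a4 := (dj x hx0).mono ss
      have := ((((((a1.pow 2).add (a2.pow 2)).add ((a3.pow 2).const_mul (3 / 2))).add
        ((a3.mul a4).div_const c)).add ((a4.pow 2).const_mul w)).div_const 2).sub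
        ((a1.const_mul ε).mul a2)
      refine this.congr_deriv ?_
      field_simp
      ring)
    (by
      have : ContinuousOn (fun τ => K * (f1 τ ^ 2 + f2 τ ^ 2 + f3 τ ^ 2 + f4 τ ^ 2)
        - d * (n τ ^ 2 + u τ ^ 2 + θ τ ^ 2 + j τ ^ 2)) (Set.Ici 0) := by fun_prop
      exact (this.mono Set.Icc_subset_Ici_self).integrableOn_Icc)
    (by
      intro x hx
      exact HD _ _ _ _ _ _ _ _)
  rw [intervalIntegral.integral_sub (iG.const_mul K) (iX.const_mul d),
    intervalIntegral.integral_const_mul, intervalIntegral.integral_const_mul] at mono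
  have E0 : E 0 ≤ _ := (HE (n 0) (u 0) (θ 0) (j 0)).2
  have Et : 0 ≤ E t := (HE (n t) (u t) (θ t) (j t)).1
  rw [div_mul_eq_mul_div, le_div_iff₀ hd]
  linarith

/-- Space-time `L²` estimate for solutions of `U′ + A(ϱ)U = F` on the annulus `r ≤ ϱ ≤ R`. -/
theorem duhamel_L2_estimate (ν κ γ a b 𝒞 r R : ℝ)
    (hν : 0 < ν) (hκ : 0 < κ) (hγ : 0 < γ) (ha : 0 < a) (hb : 0 < b) (h𝒞 : 0 < 𝒞)
    (hr : 0 < r) (hrR : r < R) :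
    ∃ C : ℝ, 0 < C ∧
      ∀ (ϱ : ℝ), r ≤ ϱ → ϱ ≤ R →
        ∀ (F U : ℝ → EuclideanSpace ℂ (Fin 4)),
          ContinuousOn F (Set.Ici 0) →
          (∀ t ∈ Set.Ici (0 : ℝ),
            HasDerivWithinAt U
              (F t - Matrix.toEuclideanLin ((radA ν κ γ a b 𝒞 ϱ).map Complex.ofReal) (U t))
              (Set.Ici 0) t) →
          ∀ t : ℝ, 0 ≤ t →
            (∫ τ in (0 : ℝ)..t, ‖U τ‖ ^ 2) ≤
              C * (‖U 0‖ ^ 2 + ∫ τ in (0 : ℝ)..t, ‖F τ‖ ^ 2) := by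
  obtain ⟨C, hC, H⟩ := stage4 ν κ γ a b 𝒞 r R hν hκ hγ ha hb h𝒞 hr hrR
  refine ⟨C, hC, ?_⟩
  intro ϱ h1 h2 F U cF dU t ht
  have sub : Set.uIcc 0 t ⊆ Set.Ici 0 := by
    rw [Set.uIcc_of_le ht]; exact Set.Icc_subset_Ici_self
  have cU : ContinuousOn U (Set.Ici 0) := fun x hx => (dU x hx).continuousWithinAt
  have projc : ∀ G : ℝ → EuclideanSpace ℂ (Fin 4), ContinuousOn G (Set.Ici 0) → ∀ i,
      ContinuousOn (fun τ => G τ i) (Set.Ici 0) := by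
    intro G hG i
    exact (EuclideanSpace.proj (𝕜 := ℂ) i).continuous.comp_continuousOn hG
  have cre : ∀ G : ℝ → EuclideanSpace ℂ (Fin 4), ContinuousOn G (Set.Ici 0) → ∀ i,
      ContinuousOn (fun τ => (G τ i).re) (Set.Ici 0) := fun G hG i =>
    Complex.continuous_re.comp_continuousOn (projc G hG i)
  have cim : ∀ G : ℝ → EuclideanSpace ℂ (Fin 4), ContinuousOn G (Set.Ici 0) → ∀ i,
      ContinuousOn (fun τ => (G τ i).im) (Set.Ici 0) := fun G hG i =>
    Complex.continuous_im.comp_continuousOn (projc G hG i)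
  have dP : ∀ i, ∀ x ∈ Set.Ici (0 : ℝ), HasDerivWithinAt (fun τ => U τ i)
      ((F x - Matrix.toEuclideanLin ((radA ν κ γ a b 𝒞 ϱ).map Complex.ofReal) (U x)) i)
      (Set.Ici 0) x := by
    intro i x hx
    exact ((EuclideanSpace.proj (𝕜 := ℂ) (ι := Fin 4) i).restrictScalars ℝ).hasFDerivAt.comp_hasDerivWithinAt x
      (dU x hx)
  have dre : ∀ i, ∀ x ∈ Set.Ici (0 : ℝ), HasDerivWithinAt (fun τ => (U τ i).re)
      ((F x - Matrix.toEuclideanLin ((radA ν κ γ a b 𝒞 ϱ).map Complex.ofReal) (U x)) i).re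
      (Set.Ici 0) x := fun i x hx =>
    Complex.reCLM.hasFDerivAt.comp_hasDerivWithinAt x (dP i x hx)
  have dim : ∀ i, ∀ x ∈ Set.Ici (0 : ℝ), HasDerivWithinAt (fun τ => (U τ i).im)
      ((F x - Matrix.toEuclideanLin ((radA ν κ γ a b 𝒞 ϱ).map Complex.ofReal) (U x)) i).im
      (Set.Ici 0) x := fun i x hx =>
    Complex.imCLM.hasFDerivAt.comp_hasDerivWithinAt x (dP i x hx)
  have entry : ∀ x i, (F x - Matrix.toEuclideanLin
      ((radA ν κ γ a b 𝒞 ϱ).map Complex.ofReal) (U x)) i =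
      F x i - ∑ k, ((radA ν κ γ a b 𝒞 ϱ i k : ℝ) : ℂ) * U x k := by
    intro x i
    simp [Matrix.toLpLin_apply, Matrix.mulVec, dotProduct]
  have Hre := H ϱ h1 h2 _ _ _ _ _ _ _ _ (cre F cF 0) (cre F cF 1) (cre F cF 2) (cre F cF 3)
    (fun x hx => (dre 0 x hx).congr_deriv (by
      rw [entry]; simp [Fin.sum_univ_four, radA, -Complex.ofReal_mul, -Complex.ofReal_neg, -Complex.ofReal_div, -Complex.ofReal_add, -Complex.ofReal_pow]))
    (fun x hx => (dre 1 x hx).congr_deriv (by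
      rw [entry]; simp [Fin.sum_univ_four, radA, -Complex.ofReal_mul, -Complex.ofReal_neg, -Complex.ofReal_div, -Complex.ofReal_add, -Complex.ofReal_pow]))
    (fun x hx => (dre 2 x hx).congr_deriv (by
      rw [entry]; simp [Fin.sum_univ_four, radA, -Complex.ofReal_mul, -Complex.ofReal_neg, -Complex.ofReal_div, -Complex.ofReal_add, -Complex.ofReal_pow]))
    (fun x hx => (dre 3 x hx).congr_deriv (by
      rw [entry]; simp [Fin.sum_univ_four, radA, -Complex.ofReal_mul, -Complex.ofReal_neg, -Complex.ofReal_div, -Complex.ofReal_add, -Complex.ofReal_pow]))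
    t ht
  have Him := H ϱ h1 h2 _ _ _ _ _ _ _ _ (cim F cF 0) (cim F cF 1) (cim F cF 2) (cim F cF 3)
    (fun x hx => (dim 0 x hx).congr_deriv (by
      rw [entry]; simp [Fin.sum_univ_four, radA, -Complex.ofReal_mul, -Complex.ofReal_neg, -Complex.ofReal_div, -Complex.ofReal_add, -Complex.ofReal_pow]))
    (fun x hx => (dim 1 x hx).congr_deriv (by
      rw [entry]; simp [Fin.sum_univ_four, radA, -Complex.ofReal_mul, -Complex.ofReal_neg, -Complex.ofReal_div, -Complex.ofReal_add, -Complex.ofReal_pow]))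
    (fun x hx => (dim 2 x hx).congr_deriv (by
      rw [entry]; simp [Fin.sum_univ_four, radA, -Complex.ofReal_mul, -Complex.ofReal_neg, -Complex.ofReal_div, -Complex.ofReal_add, -Complex.ofReal_pow]))
    (fun x hx => (dim 3 x hx).congr_deriv (by
      rw [entry]; simp [Fin.sum_univ_four, radA, -Complex.ofReal_mul, -Complex.ofReal_neg, -Complex.ofReal_div, -Complex.ofReal_add, -Complex.ofReal_pow]))
    t ht
  have nrm : ∀ v : EuclideanSpace ℂ (Fin 4), ‖v‖ ^ 2 =
      ((v 0).re ^ 2 + (v 1).re ^ 2 + (v 2).re ^ 2 + (v 3).re ^ 2) +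
      ((v 0).im ^ 2 + (v 1).im ^ 2 + (v 2).im ^ 2 + (v 3).im ^ 2) := by
    intro v
    rw [EuclideanSpace.norm_sq_eq, Fin.sum_univ_four]
    simp only [Complex.sq_norm, Complex.normSq_apply]
    ring
  have split : ∀ G : ℝ → EuclideanSpace ℂ (Fin 4), ContinuousOn G (Set.Ici 0) →
      (∫ τ in (0 : ℝ)..t, ‖G τ‖ ^ 2) =
      (∫ τ in (0 : ℝ)..t,
        ((G τ 0).re ^ 2 + (G τ 1).re ^ 2 + (G τ 2).re ^ 2 + (G τ 3).re ^ 2)) +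
      ∫ τ in (0 : ℝ)..t,
        ((G τ 0).im ^ 2 + (G τ 1).im ^ 2 + (G τ 2).im ^ 2 + (G τ 3).im ^ 2) := by
    intro G hG
    have c1 := cre G hG
    have c2 := cim G hG
    rw [← intervalIntegral.integral_add]
    · simp only [nrm]
    · refine ContinuousOn.intervalIntegrable (ContinuousOn.mono ?_ sub)
      exact ((((c1 0).pow 2).add ((c1 1).pow 2)).add ((c1 2).pow 2)).add ((c1 3).pow 2)
    · refine ContinuousOn.intervalIntegrable (ContinuousOn.mono ?_ sub)
      exact ((((c2 0).pow 2).add ((c2 1).pow 2)).add ((c2 2).pow 2)).add ((c2 3).pow 2)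
  rw [split U cU, split F cF, nrm (U 0)]
  linarith
end

section
/- Let ν, κ, γ, a, b, 𝒞 be positive real constants and define c₁ = (b + γ/(3𝒞))/(3b𝒞 + 2γ), c₂ = 1/(3b𝒞 + 2γ), c₃ = (2κb𝒞 + 2aγ)/(3b𝒞 + 2γ), c₄ = (6a𝒞 − 4κ𝒞)/(3b𝒞 + 2γ), c₅(ϱ) = (4κγ + 9ab𝒞)ϱ²/(3(3b𝒞 + 2γ)) + (2/3)γ + b𝒞, c₆ = (2κγb − 3abγ)/(3(3b𝒞 + 2γ)). Then there exist positive constants β₃, r₀ and C₄, depending only on ν, κ, γ, a, b, 𝒞, with the following property: for every ϱ with 0 ≤ ϱ ≤ r₀ and every differentiable solution (ρ, d, Θ, Ξ) : [0, ∞) → ℂ⁴ of the homogeneous system ρ′ + ϱd = 0; d′ − ϱρ + νϱ²d − c₁ϱΘ − c₂ϱΞ = 0; Θ′ + 2𝒞ϱd + c₃ϱ²Θ − c₄ϱ²Ξ = 0; Ξ′ + (2γ/3)ϱd + c₅(ϱ)Ξ − c₆ϱ²Θ = 0, the functional ℒ(t) := (1/2)|ρ(t)|² − β₃ϱ·Re(ρ(t)·conj(d(t)))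 + (1/2)|d(t)|² + (c₁/(4𝒞))|Θ(t)|² + (3c₂/(4γ))|Ξ(t)|² satisfies ℒ(t) ≤ e^{−C₄ϱ²t}·ℒ(0) for all t ≥ 0. -/
open Complex Set

set_option maxHeartbeats 1000000 in
lemma quad_aux (ν c₁ c₂ A B E m n : ℝ) (hν : 0 < ν) (hA : 0 < A) (hB : 0 < B)
    (hm : 0 < m) (hn : 0 < n) :
    ∃ β r₀ C : ℝ, 0 < β ∧ 0 < r₀ ∧ 0 < C ∧ ∀ r : ℝ, 0 ≤ r → r ≤ r₀ → ∀ x y z w : ℝ,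
      -(ν * r ^ 2 * y ^ 2) + β * r ^ 2 * y ^ 2 - β * r ^ 2 * x ^ 2 + β * ν * r ^ 3 * (x * y)
        - β * c₁ * r ^ 2 * (x * z) - β * c₂ * r ^ 2 * (x * w) - A * r ^ 2 * z ^ 2 - B * w ^ 2
        + E * r ^ 2 * (z * w)
      ≤ -(C * r ^ 2) * (1 / 2 * x ^ 2 - β * r * (x * y) + 1 / 2 * y ^ 2 + m * z ^ 2 + n * w ^ 2) := by
  obtain ⟨β, hβ, h1, h2, h3, h4⟩ : ∃ β : ℝ, 0 < β ∧ β ≤ ν / 4 ∧ β * ν ^ 2 ≤ ν / 4 ∧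
      β * c₁ ^ 2 ≤ A / 4 ∧ β ≤ 1 := by
    refine ⟨min (min (ν / 4) (ν / 4 / ν ^ 2)) (min (A / 4 / (c₁ ^ 2 + 1)) 1), by positivity,
      ?_, ?_, ?_, ?_⟩
    · exact (min_le_left _ _).trans (min_le_left _ _)
    · rw [← le_div_iff₀ (by positivity)]
      exact (min_le_left _ _).trans (min_le_right _ _)
    · have : min (min (ν / 4) (ν / 4 / ν ^ 2)) (min (A / 4 / (c₁ ^ 2 + 1)) 1) ≤
        A / 4 / (c₁ ^ 2 + 1) := (min_le_right _ _).trans (min_le_left _ _)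
      have h0 : 0 < min (min (ν / 4) (ν / 4 / ν ^ 2)) (min (A / 4 / (c₁ ^ 2 + 1)) 1) := by
        positivity
      rw [le_div_iff₀ (by positivity)] at this
      nlinarith
    · exact (min_le_right _ _).trans (min_le_right _ _)
  obtain ⟨s, hs, s1, s2⟩ : ∃ s : ℝ, 0 < s ∧ s ≤ 1 / 2 ∧
      s * (β * c₂ ^ 2 + E ^ 2 / A + 1) ≤ B / 2 := by
    refine ⟨min (1 / 2) (B / 2 / (β * c₂ ^ 2 + E ^ 2 / A + 1)), by positivity,
      min_le_left _ _, ?_⟩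
    rw [← le_div_iff₀ (by positivity)]
    exact min_le_right _ _
  obtain ⟨C, hC, k1, k2, k3, k4⟩ : ∃ C : ℝ, 0 < C ∧ C ≤ β / 4 ∧ C ≤ ν / 2 ∧
      C * m ≤ A / 4 ∧ C * n ≤ B / 2 := by
    refine ⟨min (min (β / 4) (ν / 2)) (min (A / 4 / m) (B / 2 / n)), by positivity,
      (min_le_left _ _).trans (min_le_left _ _), (min_le_left _ _).trans (min_le_right _ _), ?_, ?_⟩
    · rw [← le_div_iff₀ (by positivity)]
      exact (min_le_right _ _).trans (min_le_left _ _)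
    · rw [← le_div_iff₀ (by positivity)]
      exact (min_le_right _ _).trans (min_le_right _ _)
  refine ⟨β, s, C, hβ, hs, hC, ?_⟩
  intro r hr hrs x y z w
  have hr1 : r ≤ 1 / 2 := hrs.trans s1
  have hr2 : r ^ 2 ≤ r := by nlinarith
  have hr3 : r ^ 2 ≤ 1 := by nlinarith
  -- Young inequalities
  have y1 : β * ν * r * (x * y) ≤ β / 4 * x ^ 2 + ν / 4 * y ^ 2 := by
    have e1 : 0 ≤ β * (x / 2 - ν * r * y) ^ 2 := by positivity
    have e2 : β * ν ^ 2 * (r ^ 2 * y ^ 2) ≤ ν / 4 * (1 * y ^ 2) := by gcongr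
    nlinarith
  have y2 : -(β * c₁ * (x * z)) ≤ β / 4 * x ^ 2 + A / 4 * z ^ 2 := by
    have e1 : 0 ≤ β * (x / 2 + c₁ * z) ^ 2 := by positivity
    have e2 : β * c₁ ^ 2 * z ^ 2 ≤ A / 4 * z ^ 2 := by gcongr
    nlinarith
  have y3 : -(β * c₂ * (x * w)) ≤ β / 4 * x ^ 2 + β * c₂ ^ 2 * w ^ 2 := by
    have e1 : 0 ≤ β * (x / 2 + c₂ * w) ^ 2 := by positivity
    nlinarith
  have y4 : E * (z * w) ≤ A / 4 * z ^ 2 + E ^ 2 / A * w ^ 2 := by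
    have e1 : 0 ≤ A * (z / 2 - E / A * w) ^ 2 := by positivity
    have e2 : A * (z / 2 - E / A * w) ^ 2 = A / 4 * z ^ 2 + E ^ 2 / A * w ^ 2 - E * (z * w) := by
      field_simp
      ring
    linarith
  have y5 : r ^ 2 * (β * c₂ ^ 2 + E ^ 2 / A) * w ^ 2 ≤ B / 2 * w ^ 2 := by
    have e0 : 0 ≤ β * c₂ ^ 2 + E ^ 2 / A := by positivity
    have e1 : r ^ 2 * (β * c₂ ^ 2 + E ^ 2 / A) ≤ s * (β * c₂ ^ 2 + E ^ 2 / A) :=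
      mul_le_mul_of_nonneg_right (hr2.trans hrs) e0
    apply mul_le_mul_of_nonneg_right _ (sq_nonneg w)
    nlinarith
  have y6 : 1 / 2 * x ^ 2 - β * r * (x * y) + 1 / 2 * y ^ 2 + m * z ^ 2 + n * w ^ 2
      ≤ x ^ 2 + y ^ 2 + m * z ^ 2 + n * w ^ 2 := by
    have e0 : 0 ≤ β * r := by positivity
    have e1 : β * r ≤ 1 := by nlinarith
    have e2 : 0 ≤ β * r * (x + y) ^ 2 := by positivity
    have e3 : 0 ≤ (1 - β * r) * (x ^ 2 + y ^ 2) :=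
      mul_nonneg (by linarith) (by positivity)
    linarith
  have y7 := mul_le_mul_of_nonneg_left y6 hC.le
  have z1 := mul_le_mul_of_nonneg_right k1 (sq_nonneg x)
  have z2 := mul_le_mul_of_nonneg_right k2 (sq_nonneg y)
  have z3 := mul_le_mul_of_nonneg_right k3 (sq_nonneg z)
  have z4 : r ^ 2 * (C * n * w ^ 2) ≤ B / 2 * w ^ 2 := by
    have := mul_le_mul_of_nonneg_right k4 (sq_nonneg w)
    have h0 : 0 ≤ C * n * w ^ 2 := by positivity
    have h5 := mul_le_mul_of_nonneg_right hr3 h0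
    linarith
  have z5 := mul_le_mul_of_nonneg_right h1 (sq_nonneg y)
  have key : -(ν * y ^ 2) + β * y ^ 2 - β * x ^ 2 + β * ν * r * (x * y)
        - β * c₁ * (x * z) - β * c₂ * (x * w) - A * z ^ 2
        + E * (z * w) + C * (1 / 2 * x ^ 2 - β * r * (x * y) + 1 / 2 * y ^ 2 + m * z ^ 2 + n * w ^ 2)
        ≤ (β * c₂ ^ 2 + E ^ 2 / A) * w ^ 2 + C * n * w ^ 2 := by
    have hz : 0 ≤ A * z ^ 2 := by positivity
    linarith
  have key2 := mul_le_mul_of_nonneg_left key (sq_nonneg r)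
  linarith

/-- Exponential decay of the low-frequency Lyapunov functional for the homogeneous
transformed linearized diffusion-approximation radiation hydrodynamics system. -/
theorem lyapunov_exponential_decay (ν κ γ a b 𝒞 : ℝ)
    (hν : 0 < ν) (hκ : 0 < κ) (hγ : 0 < γ) (ha : 0 < a) (hb : 0 < b) (h𝒞 : 0 < 𝒞)
    (c₁ c₂ c₃ c₄ c₆ : ℝ)
    (hc₁ : c₁ = (b + γ / (3 * 𝒞)) / (3 * b * 𝒞 + 2 * γ))
    (hc₂ : c₂ = 1 / (3 * b * 𝒞 + 2 * γ))
    (hc₃ : c₃ = (2 * κ * b * 𝒞 + 2 * a * γ) / (3 * b * 𝒞 + 2 * γ))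
    (hc₄ : c₄ = (6 * a * 𝒞 - 4 * κ * 𝒞) / (3 * b * 𝒞 + 2 * γ))
    (hc₆ : c₆ = (2 * κ * γ * b - 3 * a * b * γ) / (3 * (3 * b * 𝒞 + 2 * γ))) :
    ∃ β₃ r₀ C₄ : ℝ, 0 < β₃ ∧ 0 < r₀ ∧ 0 < C₄ ∧
      ∀ ϱ : ℝ, 0 ≤ ϱ → ϱ ≤ r₀ →
        ∀ ρ d Θ Ξ : ℝ → ℂ,
          (∀ t ∈ Ici (0 : ℝ),
            HasDerivWithinAt ρ (-((ϱ : ℂ) * d t)) (Ici 0) t) →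
          (∀ t ∈ Ici (0 : ℝ),
            HasDerivWithinAt d
              ((ϱ : ℂ) * ρ t - (ν * ϱ ^ 2 : ℝ) * d t + (c₁ * ϱ : ℝ) * Θ t
                + (c₂ * ϱ : ℝ) * Ξ t) (Ici 0) t) →
          (∀ t ∈ Ici (0 : ℝ),
            HasDerivWithinAt Θ
              (-((2 * 𝒞 * ϱ : ℝ) * d t) - (c₃ * ϱ ^ 2 : ℝ) * Θ t
                + (c₄ * ϱ ^ 2 : ℝ) * Ξ t) (Ici 0) t) →
          (∀ t ∈ Ici (0 : ℝ),
            HasDerivWithinAt Ξ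
              (-((2 * γ / 3 * ϱ : ℝ) * d t)
                - (((4 * κ * γ + 9 * a * b * 𝒞) * ϱ ^ 2 / (3 * (3 * b * 𝒞 + 2 * γ))
                    + (2 / 3) * γ + b * 𝒞 : ℝ)) * Ξ t
                + (c₆ * ϱ ^ 2 : ℝ) * Θ t) (Ici 0) t) →
          ∀ t : ℝ, 0 ≤ t →
            (1 / 2) * ‖ρ t‖ ^ 2 - β₃ * ϱ * (ρ t * (starRingEnd ℂ) (d t)).re
              + (1 / 2) * ‖d t‖ ^ 2 + (c₁ / (4 * 𝒞)) * ‖Θ t‖ ^ 2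
              + (3 * c₂ / (4 * γ)) * ‖Ξ t‖ ^ 2 ≤
            Real.exp (-C₄ * ϱ ^ 2 * t) *
              ((1 / 2) * ‖ρ 0‖ ^ 2 - β₃ * ϱ * (ρ 0 * (starRingEnd ℂ) (d 0)).re
                + (1 / 2) * ‖d 0‖ ^ 2 + (c₁ / (4 * 𝒞)) * ‖Θ 0‖ ^ 2
                + (3 * c₂ / (4 * γ)) * ‖Ξ 0‖ ^ 2) := by
  have hD : 0 < 3 * b * 𝒞 + 2 * γ := by positivity
  have p1 : 0 < c₁ := by rw [hc₁]; positivity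
  have p2 : 0 < c₂ := by rw [hc₂]; positivity
  have p3 : 0 < c₃ := by rw [hc₃]; positivity
  clear hc₁ hc₂ hc₃ hc₄ hc₆
  obtain ⟨m, hm⟩ : ∃ m, m = c₁ / (4 * 𝒞) := ⟨_, rfl⟩
  obtain ⟨n, hn⟩ : ∃ n, n = 3 * c₂ / (4 * γ) := ⟨_, rfl⟩
  have hm0 : 0 < m := by rw [hm]; positivity
  have hn0 : 0 < n := by rw [hn]; positivity
  have e1 : c₁ = 4 * 𝒞 * m := by rw [hm]; field_simp
  have e2 : c₂ = 4 * γ / 3 * n := by rw [hn]; field_simp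
  rw [← hm, ← hn]
  clear hm hn
  obtain ⟨β, r₀, C, hβ, hr₀, hC, H⟩ := quad_aux ν c₁ c₂ (2 * m * c₃)
    (2 * n * ((2 / 3) * γ + b * 𝒞)) (2 * m * c₄ + 2 * n * c₆) m n hν (by positivity)
    (by positivity) hm0 hn0
  refine ⟨β, r₀, C, hβ, hr₀, hC, ?_⟩
  intro r hr hrr ρ d Θ Ξ hρ hd hΘ hΞ
  obtain ⟨q, hq⟩ : ∃ q, q = (4 * κ * γ + 9 * a * b * 𝒞) * r ^ 2 / (3 * (3 * b * 𝒞 + 2 * γ)) :=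
    ⟨_, rfl⟩
  have hq0 : 0 ≤ q := by rw [hq]; positivity
  rw [← hq] at hΞ
  clear hq
  have re_aux : ∀ (f : ℝ → ℂ) (f' : ℂ) (t : ℝ), HasDerivWithinAt f f' (Ici 0) t →
      HasDerivWithinAt (fun s => (f s).re) f'.re (Ici 0) t := fun f f' t h =>
    (Complex.reCLM.hasFDerivAt.comp_hasDerivWithinAt t h)
  have im_aux : ∀ (f : ℝ → ℂ) (f' : ℂ) (t : ℝ), HasDerivWithinAt f f' (Ici 0) t →
      HasDerivWithinAt (fun s => (f s).im) f'.im (Ici 0) t := fun f f' t h =>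
    (Complex.imCLM.hasFDerivAt.comp_hasDerivWithinAt t h)
  let Q : ℝ → ℝ → ℝ → ℝ → ℝ := fun x y z w =>
    1 / 2 * x ^ 2 - β * r * (x * y) + 1 / 2 * y ^ 2 + m * z ^ 2 + n * w ^ 2
  have hQ : ∀ (x y z w : ℝ → ℝ) (x' y' z' w' t : ℝ), HasDerivWithinAt x x' (Ici 0) t →
      HasDerivWithinAt y y' (Ici 0) t → HasDerivWithinAt z z' (Ici 0) t →
      HasDerivWithinAt w w' (Ici 0) t →
      x' = -(r * y t) →
      y' = r * x t - ν * r ^ 2 * y t + c₁ * r * z t + c₂ * r * w t →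
      z' = -(2 * 𝒞 * r * y t) - c₃ * r ^ 2 * z t + c₄ * r ^ 2 * w t →
      w' = -(2 * γ / 3 * r * y t) - (q + 2 / 3 * γ + b * 𝒞) * w t + c₆ * r ^ 2 * z t →
      ∃ D, HasDerivWithinAt (fun s => Q (x s) (y s) (z s) (w s)) D (Ici 0) t ∧
        D ≤ -(C * r ^ 2) * Q (x t) (y t) (z t) (w t) := by
    intro x y z w x' y' z' w' t hx hy hz hw ex ey ez ew
    refine ⟨_, (((((hx.pow 2).const_mul (1 / 2)).sub ((hx.mul hy).const_mul (β * r))).add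
      ((hy.pow 2).const_mul (1 / 2))).add ((hz.pow 2).const_mul m)).add
      ((hw.pow 2).const_mul n), ?_⟩
    have h := H r hr hrr (x t) (y t) (z t) (w t)
    refine le_trans ?_ h
    have hqw : 0 ≤ n * (q * w t ^ 2) := by positivity
    rw [ex, ey, ez, ew, e1, e2]
    norm_num
    nlinarith
  have hL : ∀ t, (1 / 2) * ‖ρ t‖ ^ 2 - β * r * (ρ t * (starRingEnd ℂ) (d t)).re
              + (1 / 2) * ‖d t‖ ^ 2 + m * ‖Θ t‖ ^ 2 + n * ‖Ξ t‖ ^ 2 =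
      Q (ρ t).re (d t).re (Θ t).re (Ξ t).re + Q (ρ t).im (d t).im (Θ t).im (Ξ t).im := by
    intro t
    simp only [Complex.sq_norm, Complex.normSq_apply, Complex.mul_re, Complex.conj_re,
      Complex.conj_im, Q]
    ring
  intro t ht
  rw [hL, hL]
  let L : ℝ → ℝ := fun t =>
      Q (ρ t).re (d t).re (Θ t).re (Ξ t).re + Q (ρ t).im (d t).im (Θ t).im (Ξ t).im
  have hL' : ∀ t ∈ Ici (0 : ℝ), ∃ D, HasDerivWithinAt L D (Ici 0) t ∧ D ≤ -(C * r ^ 2) * L t := by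
    intro t ht
    obtain ⟨D1, h1, h1'⟩ := hQ _ _ _ _ _ _ _ _ t (re_aux _ _ t (hρ t ht)) (re_aux _ _ t (hd t ht))
      (re_aux _ _ t (hΘ t ht)) (re_aux _ _ t (hΞ t ht))
      (by simp) (by simp [← Complex.ofReal_pow, ← Complex.ofReal_mul])
      (by simp [← Complex.ofReal_pow, ← Complex.ofReal_mul])
      (by simp only [Complex.add_re, Complex.sub_re, Complex.neg_re, Complex.re_ofReal_mul])
    obtain ⟨D2, h2, h2'⟩ := hQ _ _ _ _ _ _ _ _ t (im_aux _ _ t (hρ t ht)) (im_aux _ _ t (hd t ht))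
      (im_aux _ _ t (hΘ t ht)) (im_aux _ _ t (hΞ t ht))
      (by simp) (by simp only [Complex.add_im, Complex.sub_im, Complex.neg_im, Complex.im_ofReal_mul])
      (by simp only [Complex.add_im, Complex.sub_im, Complex.neg_im, Complex.im_ofReal_mul])
      (by simp only [Complex.add_im, Complex.sub_im, Complex.neg_im, Complex.im_ofReal_mul])
    refine ⟨_, h1.add h2, ?_⟩
    simp only [L]
    linarith
  choose! D hD1 hD2 using hL'
  have hE : ∀ t, HasDerivAt (fun s => Real.exp (C * r ^ 2 * s))
      (Real.exp (C * r ^ 2 * t) * (C * r ^ 2 * 1)) t := fun t =>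
    ((hasDerivAt_id t).const_mul (C * r ^ 2)).exp
  have hG : ∀ t ∈ Ici (0 : ℝ), HasDerivWithinAt (fun s => Real.exp (C * r ^ 2 * s) * L s)
      (Real.exp (C * r ^ 2 * t) * (C * r ^ 2 * 1) * L t + Real.exp (C * r ^ 2 * t) * D t)
      (Ici 0) t := fun t ht => (hE t).hasDerivWithinAt.mul (hD1 t ht)
  have anti : AntitoneOn (fun s => Real.exp (C * r ^ 2 * s) * L s) (Ici 0) := by
    apply antitoneOn_of_hasDerivWithinAt_nonpos (convex_Ici 0)
      (fun t ht => (hG t ht).continuousWithinAt)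
      (fun t ht => (hG t (interior_subset ht)).mono interior_subset)
    intro t ht
    have h := hD2 t (interior_subset ht)
    have := mul_le_mul_of_nonneg_left h (Real.exp_pos (C * r ^ 2 * t)).le
    linarith
  have fin := anti (mem_Ici.2 le_rfl) (mem_Ici.2 ht) ht
  simp only [mul_zero, Real.exp_zero, one_mul] at fin
  change L t ≤ Real.exp (-C * r ^ 2 * t) * L 0
  have h := mul_le_mul_of_nonneg_left fin (Real.exp_pos (-C * r ^ 2 * t)).le
  rw [← mul_assoc, ← Real.exp_add] at h
  have h0 : -C * r ^ 2 * t + C * r ^ 2 * t = 0 := by ring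
  rw [h0, Real.exp_zero, one_mul] at h
  exact h
end

section
/- There exists a constant C > 0 such that for every smooth compactly supported function f : ℝ³ → ℝ one has ‖f‖_{L^∞(ℝ³)} ≤ C · ‖∇f‖_{L²(ℝ³)}^{1/2} · ( ‖∇f‖_{L²(ℝ³)}² + ‖∇²f‖_{L²(ℝ³)}² )^{1/4}. -/
open MeasureTheory
open scoped SchwartzMap FourierTransform LineDeriv

abbrev E3 := EuclideanSpace ℝ (Fin 3)

lemma agm_integrable : Integrable (fun x : E3 => 1 / (‖x‖ ^ 2 + ‖x‖ ^ 4)) := by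
  rw [integrable_fun_norm_addHaar (μ := (volume : Measure E3)) (f := fun r : ℝ => 1 / (r ^ 2 + r ^ 4))]
  have h := integrable_inv_one_add_sq.integrableOn (s := Set.Ioi (0:ℝ))
  refine h.congr_fun (fun r hr => ?_) measurableSet_Ioi
  have hr : (0:ℝ) < r := hr
  simp only [finrank_euclideanSpace, Fintype.card_fin, smul_eq_mul]
  norm_num
  field_simp

lemma agm_scale (s : ℝ) (hs : 0 < s) :
    Integrable (fun x : E3 => 1 / (s * ‖x‖ ^ 2 + s⁻¹ * ‖x‖ ^ 4)) ∧
    ∫ x : E3, 1 / (s * ‖x‖ ^ 2 + s⁻¹ * ‖x‖ ^ 4) = ∫ x : E3, 1 / (‖x‖ ^ 2 + ‖x‖ ^ 4) := by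
  have key : (fun x : E3 => 1 / (s * ‖x‖ ^ 2 + s⁻¹ * ‖x‖ ^ 4)) =
      fun x : E3 => (s ^ 3)⁻¹ * (fun x : E3 => 1 / (‖x‖ ^ 2 + ‖x‖ ^ 4)) (s⁻¹ • x) := by
    funext x
    simp only [norm_smul, norm_inv, Real.norm_eq_abs, abs_of_pos hs]
    rw [one_div, one_div, ← mul_inv]
    congr 1
    field_simp
  constructor
  · rw [key]
    exact (agm_integrable.comp_smul (inv_ne_zero hs.ne')).const_mul _
  · rw [key, integral_const_mul, Measure.integral_comp_inv_smul_of_nonneg volume (fun x : E3 => 1 / (‖x‖ ^ 2 + ‖x‖ ^ 4)) hs.le]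
    simp only [finrank_euclideanSpace, Fintype.card_fin, smul_eq_mul]
    field_simp

lemma agm_fourier_line (F : 𝓢(E3, ℂ)) (i : Fin 3) (ξ : E3) :
    ‖𝓕 (∂_{EuclideanSpace.single i (1:ℝ)} F) ξ‖ = 2 * Real.pi * |ξ i| * ‖𝓕 F ξ‖ := by
  rw [SchwartzMap.fourier_lineDerivOp_eq]
  have : (inner ℝ · (EuclideanSpace.single i (1:ℝ)) : E3 → ℝ).HasTemperateGrowth := by fun_prop
  rw [smul_apply, SchwartzMap.smulLeftCLM_apply_apply this]
  simp [EuclideanSpace.inner_single_right, abs_of_pos Real.pi_pos, mul_assoc]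

lemma agm_intsq (G : 𝓢(E3, ℂ)) : Integrable (fun x => ‖G x‖ ^ 2) := by
  exact (G.memLp 2 volume).integrable_norm_pow (p := 2) (by norm_num)

lemma agm_fourier (F : 𝓢(E3, ℂ)) (A B s t : ℝ) (hs : 0 < s) (ht : 0 < t)
    (hA : ∀ i : Fin 3, ∫ x, ‖(∂_{EuclideanSpace.single i (1:ℝ)} F : 𝓢(E3, ℂ)) x‖ ^ 2 ≤ A)
    (hB : ∀ i : Fin 3, ∫ x, ‖(∂_{EuclideanSpace.single i (1:ℝ)} (∂_{EuclideanSpace.single i (1:ℝ)} F : 𝓢(E3, ℂ)) : 𝓢(E3, ℂ)) x‖ ^ 2 ≤ B)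
    (x : E3) :
    ‖F x‖ ≤ t * (∫ x : E3, 1 / (‖x‖ ^ 2 + ‖x‖ ^ 4)) + t⁻¹ * (3 * s * A + 9 * s⁻¹ * B) := by
  obtain ⟨hi, he⟩ := agm_scale s hs
  have h1 : ‖F x‖ ≤ ∫ ξ, ‖𝓕 F ξ‖ := by
    have : F x = 𝓕⁻ (𝓕 F) x := by rw [FourierTransform.fourierInv_fourier_eq]
    rw [this, SchwartzMap.fourierInv_coe, Real.fourierInv_eq]
    refine (norm_integral_le_integral_norm _).trans ?_
    simp
  set D := fun i : Fin 3 => 𝓕 (∂_{EuclideanSpace.single i (1:ℝ)} F) with hD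
  set D2 := fun i : Fin 3 => 𝓕 (∂_{EuclideanSpace.single i (1:ℝ)} (∂_{EuclideanSpace.single i (1:ℝ)} F)) with hD2
  have hI : ∀ i, Integrable (fun ξ => s * ‖D i ξ‖ ^ 2 + 3 * s⁻¹ * ‖D2 i ξ‖ ^ 2) := fun i =>
    ((agm_intsq (D i)).const_mul _).add ((agm_intsq (D2 i)).const_mul _)
  have hpt : ∀ᵐ ξ : E3, ‖𝓕 F ξ‖ ≤ t * (1 / (s * ‖ξ‖ ^ 2 + s⁻¹ * ‖ξ‖ ^ 4)) +
      t⁻¹ * ∑ i, (s * ‖D i ξ‖ ^ 2 + 3 * s⁻¹ * ‖D2 i ξ‖ ^ 2) := by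
    have h0 : ∀ᵐ ξ : E3, ξ ≠ 0 := by
      simp [ae_iff]
    filter_upwards [h0] with ξ hξ
    have hn : 0 < ‖ξ‖ := norm_pos_iff.mpr hξ
    set w := s * ‖ξ‖ ^ 2 + s⁻¹ * ‖ξ‖ ^ 4 with hw
    have hwp : 0 < w := by positivity
    have hle : w * ‖𝓕 F ξ‖ ^ 2 ≤ ∑ i, (s * ‖D i ξ‖ ^ 2 + 3 * s⁻¹ * ‖D2 i ξ‖ ^ 2) := by
      have hpi : (1:ℝ) ≤ 2 * Real.pi := by linarith [Real.pi_gt_three]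
      have hnx : ‖ξ‖ ^ 2 = ∑ i, |ξ i| ^ 2 := by
        rw [EuclideanSpace.norm_sq_eq]; simp
      have e1 : ∀ i, |ξ i| ^ 2 * ‖𝓕 F ξ‖ ^ 2 ≤ ‖D i ξ‖ ^ 2 := by
        intro i
        simp only [hD, agm_fourier_line, ← mul_pow]
        gcongr
        nlinarith [abs_nonneg (ξ i)]
      have e2 : ∀ i, |ξ i| ^ 4 * ‖𝓕 F ξ‖ ^ 2 ≤ ‖D2 i ξ‖ ^ 2 := by
        intro i
        have : ‖D2 i ξ‖ = 2 * Real.pi * |ξ i| * ‖D i ξ‖ := agm_fourier_line _ i ξ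
        calc _ = |ξ i| ^ 2 * (|ξ i| ^ 2 * ‖𝓕 F ξ‖ ^ 2) := by ring
          _ ≤ |ξ i| ^ 2 * ‖D i ξ‖ ^ 2 := by gcongr; exact e1 i
          _ = (|ξ i| * ‖D i ξ‖) ^ 2 := by ring
          _ ≤ _ := by
            rw [this]
            gcongr
            nlinarith [abs_nonneg (ξ i)]
      have e3 : ‖ξ‖ ^ 4 ≤ 3 * ∑ i, |ξ i| ^ 4 := by
        have : ‖ξ‖ ^ 4 = (‖ξ‖ ^ 2) ^ 2 := by ring
        rw [this, hnx]
        simp only [Fin.sum_univ_three]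
        nlinarith [sq_nonneg (|ξ 0| ^ 2 - |ξ 1| ^ 2), sq_nonneg (|ξ 0| ^ 2 - |ξ 2| ^ 2), sq_nonneg (|ξ 1| ^ 2 - |ξ 2| ^ 2)]
      calc w * ‖𝓕 F ξ‖ ^ 2 ≤ (s * (∑ i, |ξ i| ^ 2) + s⁻¹ * (3 * ∑ i, |ξ i| ^ 4)) * ‖𝓕 F ξ‖ ^ 2 := by
            rw [hw, ← hnx]; gcongr
        _ = ∑ i, (s * (|ξ i| ^ 2 * ‖𝓕 F ξ‖ ^ 2) + 3 * s⁻¹ * (|ξ i| ^ 4 * ‖𝓕 F ξ‖ ^ 2)) := by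
            simp only [Fin.sum_univ_three]; ring
        _ ≤ _ := by
            gcongr with i
            · exact e1 i
            · exact e2 i
    have : ‖𝓕 F ξ‖ ≤ t * (1 / w) + t⁻¹ * (w * ‖𝓕 F ξ‖ ^ 2) := by
      set a := ‖𝓕 F ξ‖
      have : t * (1 / w) + t⁻¹ * (w * a ^ 2) - a = ((t - w * a) ^ 2 + t * w * a) / (t * w) := by
        field_simp; ring
      have h2 : 0 ≤ ((t - w * a) ^ 2 + t * w * a) / (t * w) := by positivity
      linarith
    refine this.trans ?_
    gcongr
  have hIs : Integrable (fun ξ => ∑ i, (s * ‖D i ξ‖ ^ 2 + 3 * s⁻¹ * ‖D2 i ξ‖ ^ 2)) :=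
    integrable_finsetSum _ fun i _ => hI i
  have h2 := integral_mono_ae (𝓕 F).integrable.norm ((hi.const_mul t).add (hIs.const_mul t⁻¹)) hpt
  refine (h1.trans h2).trans ?_
  simp only [Pi.add_apply]
  rw [integral_add (hi.const_mul t) (hIs.const_mul t⁻¹), integral_const_mul, integral_const_mul, he]
  gcongr
  rw [integral_finsetSum _ fun i _ => hI i]
  have : ∀ i, ∫ ξ, (s * ‖D i ξ‖ ^ 2 + 3 * s⁻¹ * ‖D2 i ξ‖ ^ 2) ≤ s * A + 3 * s⁻¹ * B := by
    intro i
    rw [integral_add ((agm_intsq (D i)).const_mul _) ((agm_intsq (D2 i)).const_mul _),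
      integral_const_mul, integral_const_mul, SchwartzMap.integral_norm_sq_fourier, SchwartzMap.integral_norm_sq_fourier]
    gcongr
    · exact hA i
    · exact hB i
  refine (Finset.sum_le_sum fun i _ => this i).trans (le_of_eq ?_)
  simp; ring

lemma agm_int_cs {G : Type*} [NormedAddCommGroup G] (g : E3 → G) (hg : Continuous g)
    (hc : HasCompactSupport g) : Integrable (fun y => ‖g y‖ ^ 2) := by
  have h : HasCompactSupport (fun y => ‖g y‖ ^ 2) :=
    hc.comp_left (g := fun z => ‖z‖ ^ 2) (by simp)
  exact (hg.norm.pow 2).integrable_of_hasCompactSupport h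

lemma agm_real (f : E3 → ℝ) (hf : ContDiff ℝ (⊤ : ℕ∞) f) (hc : HasCompactSupport f) (s t : ℝ)
    (hs : 0 < s) (ht : 0 < t) (x : E3) :
    |f x| ≤ t * (∫ x : E3, 1 / (‖x‖ ^ 2 + ‖x‖ ^ 4)) +
      t⁻¹ * (3 * s * (∫ y, ‖fderiv ℝ f y‖ ^ 2) + 9 * s⁻¹ * ∫ y, ‖iteratedFDeriv ℝ 2 f y‖ ^ 2) := by
  have hc' : HasCompactSupport (fun x => (f x : ℂ)) := hc.comp_left (g := fun r : ℝ => (r:ℂ)) (by simp)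
  have hf' : ContDiff ℝ (⊤ : ℕ∞) (fun x => (f x : ℂ)) := Complex.ofRealCLM.contDiff.comp hf
  set F : 𝓢(E3, ℂ) := hc'.toSchwartzMap hf' with hF
  have hFc : (F : E3 → ℂ) = Complex.ofRealLI ∘ f := by ext; simp [hF]
  have hx : |f x| = ‖F x‖ := by simp [hFc]
  have hit : ∀ (n : ℕ) y, ‖iteratedFDeriv ℝ n F y‖ = ‖iteratedFDeriv ℝ n f y‖ := by
    intro n y
    rw [hFc]
    exact Complex.ofRealLI.norm_iteratedFDeriv_comp_left (hf.contDiffAt.of_le (by exact_mod_cast le_top)) (le_refl _)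
  have hb : ∀ (n : ℕ) (m : Fin n → E3) (hm : ∀ i, ‖m i‖ = 1) y, ‖(∂^{m} F : 𝓢(E3, ℂ)) y‖ ≤ ‖iteratedFDeriv ℝ n f y‖ := by
    intro n m hm y
    rw [SchwartzMap.iteratedLineDerivOp_eq_iteratedFDeriv, ← hit]
    refine (ContinuousMultilinearMap.le_opNorm _ _).trans ?_
    simp [hm]
  have hint : ∀ n : ℕ, Integrable (fun y => ‖iteratedFDeriv ℝ n f y‖ ^ 2) := by
    intro n
    have hcont : Continuous (iteratedFDeriv ℝ n f) := hf.continuous_iteratedFDeriv (by exact_mod_cast le_top)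
    have h1 : HasCompactSupport (iteratedFDeriv ℝ n f) := hc.iteratedFDeriv n
    exact agm_int_cs _ hcont h1
  have hbi : ∀ (n : ℕ) (m : Fin n → E3) (hm : ∀ i, ‖m i‖ = 1), ∫ y, ‖(∂^{m} F : 𝓢(E3, ℂ)) y‖ ^ 2 ≤ ∫ y, ‖iteratedFDeriv ℝ n f y‖ ^ 2 := by
    intro n m hm
    refine integral_mono (agm_intsq _) (hint n) fun y => ?_
    have := hb n m hm y
    simp only
    gcongr
  rw [hx]
  refine agm_fourier F _ _ s t hs ht (fun i => ?_) (fun i => ?_) x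
  · have := hbi 1 ![EuclideanSpace.single i 1] (by simp)
    simpa [LineDeriv.iteratedLineDerivOp_one, norm_iteratedFDeriv_one] using this
  · have := hbi 2 ![EuclideanSpace.single i 1, EuclideanSpace.single i 1] (by intro j; fin_cases j <;> simp)
    simpa [LineDeriv.iteratedLineDerivOp_succ_left] using this

theorem agmon_inequality :
    ∃ C : ℝ, 0 < C ∧
      ∀ f : EuclideanSpace ℝ (Fin 3) → ℝ,
        ContDiff ℝ (⊤ : ℕ∞) f → HasCompactSupport f →
        ∀ x : EuclideanSpace ℝ (Fin 3),
          |f x| ≤ C * (∫ y, ‖fderiv ℝ f y‖ ^ 2) ^ ((1 : ℝ) / 4) *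
            ((∫ y, ‖fderiv ℝ f y‖ ^ 2) + ∫ y, ‖iteratedFDeriv ℝ 2 f y‖ ^ 2) ^ ((1 : ℝ) / 4) := by
  set c := ∫ x : E3, 1 / (‖x‖ ^ 2 + ‖x‖ ^ 4) with hcdef
  have hc0 : 0 ≤ c := integral_nonneg fun x => by positivity
  refine ⟨c + 12, by positivity, fun f hf hcs x => ?_⟩
  have key := fun s t hs ht => agm_real f hf hcs s t hs ht x
  rw [← hcdef] at key
  have hA0 : 0 ≤ ∫ y, ‖fderiv ℝ f y‖ ^ 2 := integral_nonneg fun x => by positivity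
  have hB0 : 0 ≤ ∫ y, ‖iteratedFDeriv ℝ 2 f y‖ ^ 2 := integral_nonneg fun x => by positivity
  generalize (∫ y, ‖fderiv ℝ f y‖ ^ 2) = A at *
  generalize (∫ y, ‖iteratedFDeriv ℝ 2 f y‖ ^ 2) = B at *
  rcases hA0.eq_or_lt with h | h
  · subst h
    have : |f x| ≤ 0 := by
      refine le_of_forall_pos_le_add fun ε hε => ?_
      set M := c + 9 * B + 1
      have hM : 0 < M := by positivity
      have := key ((ε / M)⁻¹ ^ 2) (ε / M) (by positivity) (by positivity)
      refine this.trans ?_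
      have e : ε / M * c + (ε / M)⁻¹ * (3 * (ε / M)⁻¹ ^ 2 * 0 + 9 * ((ε / M)⁻¹ ^ 2)⁻¹ * B) = ε / M * (c + 9 * B) := by
        field_simp; ring
      rw [e, zero_add]
      calc ε / M * (c + 9 * B) ≤ ε / M * M := by gcongr; simp [M]
        _ = ε := by field_simp
    refine this.trans (by positivity)
  · have hH : 0 < A + B := by positivity
    set a := A ^ ((1:ℝ)/4) with ha
    set b := (A + B) ^ ((1:ℝ)/4) with hb
    have hap : 0 < a := by positivity
    have hbp : 0 < b := by positivity
    have ha4 : A = a ^ 4 := by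
      rw [ha, ← Real.rpow_natCast, ← Real.rpow_mul hA0]; norm_num
    have hb4 : A + B = b ^ 4 := by
      rw [hb, ← Real.rpow_natCast, ← Real.rpow_mul hH.le]; norm_num
    have hBb : B ≤ b ^ 4 := by linarith
    have := key (b ^ 2 / a ^ 2) (a * b) (by positivity) (by positivity)
    refine this.trans ?_
    calc _ ≤ a * b * c + (a * b)⁻¹ * (3 * (b ^ 2 / a ^ 2) * a ^ 4 + 9 * (b ^ 2 / a ^ 2)⁻¹ * b ^ 4) := by
          rw [← ha4]; gcongr
      _ = _ := by field_simp; ring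
end

section
/- Let m ≥ 1 be an integer and let p, p₁, p₂, p₃, p₄ ∈ [1, ∞] satisfy 1/p = 1/p₁ + 1/p₂ = 1/p₃ + 1/p₄. Then there exists a constant C > 0, depending only on m and the exponents, such that for all smooth compactly supported functions f, g : ℝ³ → ℝ one has ‖∇^m(fg)‖_{L^p(ℝ³)} ≤ C·( ‖f‖_{L^{p₁}(ℝ³)}·‖∇^m g‖_{L^{p₂}(ℝ³)} + ‖∇^m f‖_{L^{p₃}(ℝ³)}·‖g‖_{L^{p₄}(ℝ³)} ). -/
open MeasureTheory ENNReal

namespace Moser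

lemma lint_eq {u v : ℝ → ℝ} (hu : ∀ t, HasDerivAt u (v t) t) (hv : Continuous v) {a b : ℝ}
    (hab : a ≤ b) (hpos : ∀ t ∈ Set.Ioo a b, 0 < v t) :
    ∫⁻ t in Set.Ioo a b, ‖v t‖ₑ = ENNReal.ofReal (u b - u a) := by
  rw [← intervalIntegral.integral_eq_sub_of_hasDerivAt (fun x _ => hu x)
    (hv.intervalIntegrable a b), intervalIntegral.integral_of_le hab,
    ← restrict_Ioo_eq_restrict_Ioc, ofReal_integral_eq_lintegral_ofReal]
  · refine setLIntegral_congr_fun measurableSet_Ioo fun t ht => ?_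
    rw [Real.enorm_eq_ofReal (hpos t ht).le]
  · exact (hv.integrableOn_Icc (a := a) (b := b)).mono_set Set.Ioo_subset_Icc_self
  · exact (ae_restrict_iff' measurableSet_Ioo).2 (Filter.Eventually.of_forall
      fun t ht => (hpos t ht).le)

lemma loc_pos {u v w : ℝ → ℝ} (hu : ∀ t, HasDerivAt u (v t) t) (hv : ∀ t, HasDerivAt v (w t) t)
    (hw : Continuous w) {a b : ℝ} (hab : a < b) (hvb : v b = 0)
    (hva : v a = 0) (hpos : ∀ t ∈ Set.Ioo a b, 0 < v t) :
    ∃ δ M : ℝ, 0 < δ ∧ 0 < M ∧ (∀ t ∈ Set.Ioo a b, |v t| ≤ M) ∧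
      (∫⁻ t in Set.Ioo a b, ‖v t‖ₑ ≤ ENNReal.ofReal (δ * M)) ∧
      (∃ J ⊆ Set.Ioo a b, MeasurableSet J ∧ volume J = ENNReal.ofReal (δ / 4) ∧
        ∀ x ∈ J, M * δ / 4 ≤ |u x|) ∧
      (∃ J ⊆ Set.Ioo a b, MeasurableSet J ∧ volume J ≤ ENNReal.ofReal (2 * δ) ∧
        ENNReal.ofReal (M / 2) ≤ ∫⁻ t in J, ‖w t‖ₑ) := by
  have hvc : Continuous v := continuous_iff_continuousAt.2 fun t => (hv t).continuousAt
  have huc : Continuous u := continuous_iff_continuousAt.2 fun t => (hu t).continuousAt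
  obtain ⟨x0, hx0, hmax⟩ := isCompact_Icc.exists_isMaxOn (Set.nonempty_Icc.2 hab.le)
    hvc.continuousOn
  have hmax' : ∀ t ∈ Set.Icc a b, v t ≤ v x0 := fun t ht => hmax ht
  set M := v x0 with hM
  have hmid : (a + b) / 2 ∈ Set.Ioo a b := ⟨by linarith, by linarith⟩
  have hMpos : 0 < M := lt_of_lt_of_le (hpos _ hmid) (hmax' _ (Set.Ioo_subset_Icc_self hmid))
  have hx0a : a < x0 := lt_of_le_of_ne hx0.1 (by rintro rfl; linarith)
  have hx0b : x0 < b := lt_of_le_of_ne hx0.2 (by rintro rfl; linarith)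
  have mv : ∀ x y, x < y → ∃ c ∈ Set.Ioo x y, v c * (y - x) = u y - u x := by
    intro x y hxy
    obtain ⟨c, hc, h⟩ := exists_hasDerivAt_eq_slope u v hxy huc.continuousOn (fun t _ => hu t)
    refine ⟨c, hc, ?_⟩
    rw [h]; field_simp [sub_ne_zero.2 hxy.ne']
  have incr : ∀ x y, a ≤ x → x < y → y ≤ b → 0 < u y - u x ∧ u y - u x ≤ M * (y - x) := by
    intro x y hx hxy hy
    obtain ⟨c, hc, h⟩ := mv x y hxy
    have h1 : c ∈ Set.Ioo a b := ⟨by linarith [hc.1], by linarith [hc.2]⟩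
    have h2 := hpos c h1
    have h3 := hmax' c (Set.Ioo_subset_Icc_self h1)
    rw [← h]
    exact ⟨mul_pos h2 (by linarith), mul_le_mul_of_nonneg_right h3 (by linarith)⟩
  set D := u b - u a with hD
  obtain ⟨hDpos, hDM⟩ := incr a b le_rfl hab le_rfl
  have hδM : D / M * M = D := by field_simp
  have hδpos : 0 < D / M := div_pos hDpos hMpos
  have hδle : D / M ≤ b - a := by rw [div_le_iff₀ hMpos]; linarith
  refine ⟨D / M, M, hδpos, hMpos, ?_, ?_, ?_, ?_⟩
  · intro t ht
    rw [abs_of_pos (hpos t ht)]; exact hmax' t (Set.Ioo_subset_Icc_self ht)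
  · rw [lint_eq hu hvc hab.le hpos, hδM]
  · generalize hδ : D / M = δ at *
    have hMd : M * δ = D := by linarith
    rcases le_total (D / 2) (u b) with h | h
    · refine ⟨Set.Ioo (b - δ / 4) b, Set.Ioo_subset_Ioo_left (by linarith), measurableSet_Ioo,
        by rw [Real.volume_Ioo]; congr 1; ring, fun x hx => ?_⟩
      have := (incr x b (by linarith [hx.1]) hx.2 le_rfl).2
      have h4 : M * (b - x) ≤ M * (δ / 4) := mul_le_mul_of_nonneg_left (by linarith [hx.1]) hMpos.le
      refine le_trans ?_ (le_abs_self _)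
      linarith
    · refine ⟨Set.Ioo a (a + δ / 4), Set.Ioo_subset_Ioo_right (by linarith), measurableSet_Ioo,
        by rw [Real.volume_Ioo]; congr 1; ring, fun x hx => ?_⟩
      have := (incr a x le_rfl hx.1 (by linarith [hx.2])).2
      have h4 : M * (x - a) ≤ M * (δ / 4) := mul_le_mul_of_nonneg_left (by linarith [hx.2]) hMpos.le
      refine le_trans ?_ (neg_le_abs _)
      linarith
  · generalize hδ : D / M = δ at *
    have hMd : M * δ = D := by linarith
    set c := min (x0 + 2 * δ) b with hc
    have hcx : x0 < c := lt_min (by linarith) hx0b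
    have hy : ∃ y, x0 < y ∧ y ≤ c ∧ v y ≤ M / 2 := by
      rcases le_total (x0 + 2 * δ) b with h | h
      · obtain ⟨y, hy, h1⟩ := mv x0 (x0 + 2 * δ) (by linarith)
        refine ⟨y, hy.1, ?_, ?_⟩
        · rw [hc, min_eq_left h]; exact hy.2.le
        · by_contra! hlt
          have h2 : M / 2 * (2 * δ) < v y * (2 * δ) := mul_lt_mul_of_pos_right hlt (by linarith)
          have h3 := (incr a x0 le_rfl hx0a hx0.2).1
          have h5 : u (x0 + 2 * δ) ≤ u b := by
            rcases h.eq_or_lt with h | h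
            · rw [h]
            · linarith [(incr _ b (by linarith) h le_rfl).1]
          have h6 : x0 + 2 * δ - x0 = 2 * δ := by ring
          rw [h6] at h1
          linarith
      · exact ⟨b, hx0b, by rw [hc, min_eq_right h], by rw [hvb]; positivity⟩
    obtain ⟨y, hxy, hyc, hvy⟩ := hy
    refine ⟨Set.Ioo x0 c, Set.Ioo_subset_Ioo hx0.1 (min_le_right _ _), measurableSet_Ioo, ?_, ?_⟩
    · rw [Real.volume_Ioo]
      exact ENNReal.ofReal_le_ofReal (by linarith [min_le_left (x0 + 2 * δ) b])
    · calc ENNReal.ofReal (M / 2) ≤ ‖∫ t in x0..y, w t‖ₑ := by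
            rw [intervalIntegral.integral_eq_sub_of_hasDerivAt (fun x _ => hv x)
              (hw.intervalIntegrable _ _), ← ofReal_norm, Real.norm_eq_abs]
            refine ENNReal.ofReal_le_ofReal (le_trans ?_ (neg_le_abs _))
            linarith
        _ ≤ ∫⁻ t in Set.Ioo x0 y, ‖w t‖ₑ := by
            rw [intervalIntegral.integral_of_le hxy.le, ← restrict_Ioo_eq_restrict_Ioc]
            exact enorm_integral_le_lintegral_enorm _
        _ ≤ _ := lintegral_mono_set (Set.Ioo_subset_Ioo_right hyc)

lemma loc_ne {u v w : ℝ → ℝ} (hu : ∀ t, HasDerivAt u (v t) t) (hv : ∀ t, HasDerivAt v (w t) t)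
    (hw : Continuous w) {a b : ℝ} (hab : a < b) (hvb : v b = 0)
    (hva : v a = 0) (hne : ∀ t ∈ Set.Ioo a b, v t ≠ 0) :
    ∃ δ M : ℝ, 0 < δ ∧ 0 < M ∧ (∀ t ∈ Set.Ioo a b, |v t| ≤ M) ∧
      (∫⁻ t in Set.Ioo a b, ‖v t‖ₑ ≤ ENNReal.ofReal (δ * M)) ∧
      (∃ J ⊆ Set.Ioo a b, MeasurableSet J ∧ volume J = ENNReal.ofReal (δ / 4) ∧
        ∀ x ∈ J, M * δ / 4 ≤ |u x|) ∧
      (∃ J ⊆ Set.Ioo a b, MeasurableSet J ∧ volume J ≤ ENNReal.ofReal (2 * δ) ∧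
        ENNReal.ofReal (M / 2) ≤ ∫⁻ t in J, ‖w t‖ₑ) := by
  have hvc : Continuous v := continuous_iff_continuousAt.2 fun t => (hv t).continuousAt
  have key : (∀ t ∈ Set.Ioo a b, 0 < v t) ∨ (∀ t ∈ Set.Ioo a b, v t < 0) := by
    by_contra! h
    obtain ⟨⟨s, hs, hs'⟩, ⟨t, ht, ht'⟩⟩ := h
    obtain ⟨c, hc, h0⟩ := (isPreconnected_Ioo (a := a) (b := b)).intermediate_value hs ht
      hvc.continuousOn ⟨hs', ht'⟩
    exact hne c hc h0
  rcases key with h | h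
  · exact loc_pos hu hv hw hab hvb hva h
  · have := loc_pos (u := fun t => - u t) (v := fun t => - v t) (w := fun t => - w t)
      (fun t => (hu t).neg) (fun t => (hv t).neg) hw.neg hab (by simp [hvb]) (by simp [hva])
      (fun t ht => by simpa using h t ht)
    simpa only [abs_neg, enorm_neg] using this

noncomputable def P (a : ℝ) : ℝ≥0∞ := (ENNReal.ofReal a)⁻¹

lemma P_zero : P 0 = ⊤ := by simp [P]

lemma P_ne_zero (a : ℝ) : P a ≠ 0 := by simp [P]

lemma P_ne_top {a : ℝ} (h : 0 < a) : P a ≠ ⊤ := by simp [P, h]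

lemma P_toReal {a : ℝ} (h : 0 ≤ a) : (P a).toReal = a⁻¹ := by
  simp [P, ENNReal.toReal_inv, ENNReal.toReal_ofReal h]

lemma one_le_P {a : ℝ} (h1 : a ≤ 1) : 1 ≤ P a := by
  simpa [P] using h1

lemma eLpNorm_P {X F : Type*} [MeasurableSpace X] [NormedAddCommGroup F] {a : ℝ} (h : 0 < a)
    (f : X → F) (μ : Measure X) :
    eLpNorm f (P a) μ = (∫⁻ x, ‖f x‖ₑ ^ a⁻¹ ∂μ) ^ a := by
  rw [eLpNorm_eq_lintegral_rpow_enorm_toReal (P_ne_zero a) (P_ne_top h), P_toReal h.le]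
  simp

lemma loc_norm {u v w : ℝ → ℝ} (hu : ∀ t, HasDerivAt u (v t) t) (hv : ∀ t, HasDerivAt v (w t) t)
    (hw : Continuous w) {a b : ℝ} (hab : a < b) (hvb : v b = 0)
    (hva : v a = 0) (hne : ∀ t ∈ Set.Ioo a b, v t ≠ 0) {α β γ : ℝ} (hα : 0 ≤ α) (hα1 : α ≤ 1)
    (hβ : 0 ≤ β) (hβ1 : β ≤ 1) (hγ : 2 * γ = α + β) :
    eLpNorm v (P γ) (volume.restrict (Set.Ioo a b)) ^ 2 ≤
      64 * (eLpNorm u (P α) (volume.restrict (Set.Ioo a b)) *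
        eLpNorm w (P β) (volume.restrict (Set.Ioo a b))) := by
  obtain ⟨δ, M, hδ, hM, hvM, hint, ⟨J, hJ, hJm, hJv, hJu⟩, ⟨K, hK, hKm, hKv, hKw⟩⟩ :=
    loc_ne hu hv hw hab hvb hva hne
  set A := eLpNorm u (P α) (volume.restrict (Set.Ioo a b))
  set B := eLpNorm w (P β) (volume.restrict (Set.Ioo a b))
  set x := ENNReal.ofReal δ with hx
  set y := ENNReal.ofReal M with hy
  have hx0 : x ≠ 0 := by simpa [hx] using hδ
  have hxt : x ≠ ⊤ := ENNReal.ofReal_ne_top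
  have hy0 : y ≠ 0 := by simpa [hy] using hM
  have hyt : y ≠ ⊤ := ENNReal.ofReal_ne_top
  have hvy : ∀ t ∈ Set.Ioo a b, ‖v t‖ₑ ≤ y := fun t ht => by
    rw [← ofReal_norm, Real.norm_eq_abs]; exact ENNReal.ofReal_le_ofReal (hvM t ht)
  have h1 : eLpNorm v (P γ) (volume.restrict (Set.Ioo a b)) ≤ x ^ γ * y := by
    have hγ0 : 0 ≤ γ := by linarith
    rcases hγ0.eq_or_lt with h | h
    · rw [← h, P_zero, eLpNorm_exponent_top, ENNReal.rpow_zero, one_mul]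
      exact eLpNormEssSup_le_of_ae_enorm_bound ((ae_restrict_iff' measurableSet_Ioo).2
        (Filter.Eventually.of_forall hvy))
    · rw [eLpNorm_P h]
      have hg1 : 1 ≤ γ⁻¹ := (one_le_inv₀ h).2 (by linarith)
      calc (∫⁻ t in Set.Ioo a b, ‖v t‖ₑ ^ γ⁻¹) ^ γ ≤ (x * y ^ γ⁻¹) ^ γ := by
            refine ENNReal.rpow_le_rpow ?_ h.le
            calc ∫⁻ t in Set.Ioo a b, ‖v t‖ₑ ^ γ⁻¹
                ≤ ∫⁻ t in Set.Ioo a b, y ^ (γ⁻¹ - 1) * ‖v t‖ₑ := by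
                  refine setLIntegral_mono' measurableSet_Ioo fun t ht => ?_
                  have : ‖v t‖ₑ ≠ 0 := by simpa using hne t ht
                  calc ‖v t‖ₑ ^ γ⁻¹ = ‖v t‖ₑ ^ (γ⁻¹ - 1) * ‖v t‖ₑ := by
                        conv_rhs => rw [← ENNReal.rpow_one ‖v t‖ₑ, ← ENNReal.rpow_mul,
                          ← ENNReal.rpow_add _ _ this enorm_ne_top]
                        congr 1; ring
                    _ ≤ _ := by
                        gcongr
                        exact hvy t ht
              _ = y ^ (γ⁻¹ - 1) * ∫⁻ t in Set.Ioo a b, ‖v t‖ₑ :=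
                  lintegral_const_mul' _ _ (ENNReal.rpow_ne_top_of_nonneg (by linarith) hyt)
              _ ≤ y ^ (γ⁻¹ - 1) * (x * y) := by
                  gcongr
                  rwa [ENNReal.ofReal_mul hδ.le] at hint
              _ = x * (y ^ (γ⁻¹ - 1) * y ^ (1 : ℝ)) := by rw [ENNReal.rpow_one]; ring
              _ = x * y ^ γ⁻¹ := by
                  rw [← ENNReal.rpow_add _ _ hy0 hyt]; congr 2; ring
        _ = x ^ γ * y := by
            rw [ENNReal.mul_rpow_of_nonneg _ _ h.le, ← ENNReal.rpow_mul,
              inv_mul_cancel₀ h.ne', ENNReal.rpow_one]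
  have h2 : y * x * x ^ α ≤ 16 * A := by
    have e1 : eLpNorm (fun _ : ℝ => M * δ / 4) (P α) (volume.restrict J) ≤ A := by
      refine le_trans ?_ (eLpNorm_mono_measure _ (Measure.restrict_mono hJ le_rfl))
      refine eLpNorm_mono_ae ((ae_restrict_iff' hJm).2 (Filter.Eventually.of_forall ?_))
      intro t ht
      rw [Real.norm_eq_abs, Real.norm_eq_abs, abs_of_pos (by positivity)]
      exact hJu t ht
    have hJ0 : volume.restrict J ≠ 0 := by
      rw [Ne, Measure.restrict_eq_zero, hJv]; simp; linarith
    rw [eLpNorm_const _ (P_ne_zero α) hJ0, P_toReal hα, Measure.restrict_apply_univ, hJv,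
      one_div, inv_inv, Real.enorm_eq_ofReal (by positivity)] at e1
    have e2 : ENNReal.ofReal (M * δ / 4) = y * x / 4 := by
      rw [ENNReal.ofReal_div_of_pos (by norm_num), ENNReal.ofReal_mul hM.le]; norm_num [hx, hy]
    have e3 : ENNReal.ofReal (δ / 4) = x / 4 := by
      rw [ENNReal.ofReal_div_of_pos (by norm_num)]; norm_num [hx]
    rw [e2, e3] at e1
    have e4 : x ^ α ≤ 4 * (x / 4) ^ α := by
      calc x ^ α = (4 * (x / 4)) ^ α := by
            rw [ENNReal.mul_div_cancel (by norm_num) (by norm_num)]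
        _ = 4 ^ α * (x / 4) ^ α := ENNReal.mul_rpow_of_nonneg _ _ hα
        _ ≤ 4 ^ (1 : ℝ) * (x / 4) ^ α := by
            gcongr
            norm_num
        _ = _ := by rw [ENNReal.rpow_one]
    calc y * x * x ^ α ≤ (4 * (y * x / 4)) * (4 * (x / 4) ^ α) := by
          rw [ENNReal.mul_div_cancel (by norm_num) (by norm_num)]; gcongr
      _ = 16 * (y * x / 4 * (x / 4) ^ α) := by ring
      _ ≤ _ := by gcongr
  have h3 : y ≤ 4 * B * x ^ (1 - β) := by
    have e1 : eLpNorm w 1 (volume.restrict K) ≤ _ :=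
      eLpNorm_le_eLpNorm_mul_rpow_measure_univ (one_le_P hβ1) hw.aestronglyMeasurable
    rw [eLpNorm_one_eq_lintegral_enorm, P_toReal hβ, Measure.restrict_apply_univ, one_div, one_div,
      inv_inv, ENNReal.toReal_one, inv_one] at e1
    have e2 : ENNReal.ofReal (M / 2) = y / 2 := by
      rw [ENNReal.ofReal_div_of_pos (by norm_num)]; norm_num [hy]
    have e3 : volume K ^ (1 - β) ≤ 2 * x ^ (1 - β) := by
      calc volume K ^ (1 - β) ≤ (2 * x) ^ (1 - β) := by
            refine ENNReal.rpow_le_rpow (hKv.trans ?_) (by linarith)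
            rw [ENNReal.ofReal_mul (by norm_num)]; norm_num [hx]
        _ = 2 ^ (1 - β) * x ^ (1 - β) := ENNReal.mul_rpow_of_nonneg _ _ (by linarith)
        _ ≤ 2 ^ (1 : ℝ) * x ^ (1 - β) := by
            gcongr
            · norm_num
            · linarith
        _ = _ := by rw [ENNReal.rpow_one]
    have e4 : eLpNorm w (P β) (volume.restrict K) ≤ B :=
      eLpNorm_mono_measure _ (Measure.restrict_mono hK le_rfl)
    calc y = 2 * (y / 2) := by rw [ENNReal.mul_div_cancel (by norm_num) (by norm_num)]
      _ ≤ 2 * (B * (2 * x ^ (1 - β))) := by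
          gcongr
          rw [← e2]
          refine hKw.trans (e1.trans ?_)
          gcongr
      _ = _ := by ring
  calc eLpNorm v (P γ) (volume.restrict (Set.Ioo a b)) ^ 2 ≤ (x ^ γ * y) ^ 2 := by gcongr
    _ = (x ^ (β - 1) * x ^ (1 : ℝ) * x ^ α) * y ^ 2 := by
        rw [← ENNReal.rpow_add _ _ hx0 hxt, ← ENNReal.rpow_add _ _ hx0 hxt, mul_pow,
          ← ENNReal.rpow_mul_natCast]
        congr 2; push_cast; linarith
    _ = x ^ (β - 1) * (y * x * x ^ α) * y := by rw [ENNReal.rpow_one]; ring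
    _ ≤ x ^ (β - 1) * (16 * A) * (4 * B * x ^ (1 - β)) := by gcongr
    _ = 64 * (A * B) * (x ^ (β - 1) * x ^ (1 - β)) := by ring
    _ = 64 * (A * B) := by
        rw [← ENNReal.rpow_add _ _ hx0 hxt]; simp

lemma holder_aux {Y : Type*} [MeasurableSpace Y] {ν : Measure Y} {A B : Y → ℝ≥0∞}
    (hA : AEMeasurable A ν) (hB : AEMeasurable B ν) {α β ρ : ℝ} {a b : ℝ≥0∞}
    (hα : 0 ≤ α) (hβ : 0 ≤ β) (hρ : 0 < ρ) (h : ρ * α + ρ * β = 1)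
    (ha0 : α = 0 → ∀ y, A y ≤ a) (ha : 0 < α → ∫⁻ y, A y ^ α⁻¹ ∂ν ≤ a ^ α⁻¹)
    (hb0 : β = 0 → ∀ y, B y ≤ b) (hb : 0 < β → ∫⁻ y, B y ^ β⁻¹ ∂ν ≤ b ^ β⁻¹) :
    ∫⁻ y, A y ^ ρ * B y ^ ρ ∂ν ≤ a ^ ρ * b ^ ρ := by
  rcases hα.eq_or_lt with h0 | h0
  · have hr : ρ = β⁻¹ := by
      rw [← h0] at h; refine eq_inv_of_mul_eq_one_left (by linarith)
    have hβ0 : 0 < β := by rw [← inv_pos, ← hr]; exact hρ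
    calc ∫⁻ y, A y ^ ρ * B y ^ ρ ∂ν ≤ ∫⁻ y, a ^ ρ * B y ^ ρ ∂ν := by
          refine lintegral_mono fun y => ?_
          gcongr
          exact ha0 h0.symm y
      _ = a ^ ρ * ∫⁻ y, B y ^ ρ ∂ν := lintegral_const_mul'' _ (hB.pow_const _)
      _ ≤ _ := by gcongr; rw [hr]; exact hb hβ0
  rcases hβ.eq_or_lt with h1 | h1
  · have hr : ρ = α⁻¹ := by
      rw [← h1] at h; refine eq_inv_of_mul_eq_one_left (by linarith)
    calc ∫⁻ y, A y ^ ρ * B y ^ ρ ∂ν ≤ ∫⁻ y, A y ^ ρ * b ^ ρ ∂ν := by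
          refine lintegral_mono fun y => ?_
          gcongr
          exact hb0 h1.symm y
      _ = (∫⁻ y, A y ^ ρ ∂ν) * b ^ ρ := lintegral_mul_const'' _ (hA.pow_const _)
      _ ≤ _ := by gcongr; rw [hr]; exact ha h0
  · have e : ∀ {c : ℝ}, 0 < c → ∀ z : ℝ≥0∞, (z ^ c⁻¹) ^ (ρ * c) = z ^ ρ := by
      intro c hc z
      rw [← ENNReal.rpow_mul]; congr 1; field_simp
    calc ∫⁻ y, A y ^ ρ * B y ^ ρ ∂ν
        = ∫⁻ y, (A y ^ α⁻¹) ^ (ρ * α) * (B y ^ β⁻¹) ^ (ρ * β) ∂ν := by simp only [e h0, e h1]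
      _ ≤ (∫⁻ y, A y ^ α⁻¹ ∂ν) ^ (ρ * α) * (∫⁻ y, B y ^ β⁻¹ ∂ν) ^ (ρ * β) :=
          ENNReal.lintegral_mul_norm_pow_le (hA.pow_const _) (hB.pow_const _)
            (by positivity) (by positivity) h
      _ ≤ (a ^ α⁻¹) ^ (ρ * α) * (b ^ β⁻¹) ^ (ρ * β) := by
          gcongr
          · exact ha h0
          · exact hb h1
      _ = _ := by rw [e h0, e h1]

lemma holder_glue {Y : Type*} [MeasurableSpace Y] {ν : Measure Y} {N A B : Y → ℝ≥0∞}
    (hA : AEMeasurable A ν) (hB : AEMeasurable B ν) {α β γ : ℝ} {a b C : ℝ≥0∞} (hC : C ≠ ⊤)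
    (hN : ∀ y, N y ^ 2 ≤ C * (A y * B y))
    (hα : 0 ≤ α) (hβ : 0 ≤ β) (hγ : 0 < γ) (h : 2 * γ = α + β)
    (ha0 : α = 0 → ∀ y, A y ≤ a) (ha : 0 < α → ∫⁻ y, A y ^ α⁻¹ ∂ν ≤ a ^ α⁻¹)
    (hb0 : β = 0 → ∀ y, B y ≤ b) (hb : 0 < β → ∫⁻ y, B y ^ β⁻¹ ∂ν ≤ b ^ β⁻¹) :
    ((∫⁻ y, N y ^ γ⁻¹ ∂ν) ^ γ) ^ 2 ≤ C * (a * b) := by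
  set ρ := (2 * γ)⁻¹ with hρd
  have hρ : 0 < ρ := by positivity
  have h1 := holder_aux hA hB hα hβ hρ (by rw [← mul_add, ← h]; exact inv_mul_cancel₀ (by positivity))
    ha0 ha hb0 hb
  have h2 : ∫⁻ y, N y ^ γ⁻¹ ∂ν ≤ (C * (a * b)) ^ ρ := by
    calc ∫⁻ y, N y ^ γ⁻¹ ∂ν ≤ ∫⁻ y, C ^ ρ * (A y ^ ρ * B y ^ ρ) ∂ν := by
          refine lintegral_mono fun y => ?_
          rw [← ENNReal.mul_rpow_of_nonneg _ _ hρ.le, ← ENNReal.mul_rpow_of_nonneg _ _ hρ.le]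
          calc N y ^ γ⁻¹ = (N y ^ 2) ^ ρ := by
                rw [← ENNReal.rpow_natCast_mul]; congr 1; rw [hρd]; push_cast; field_simp
            _ ≤ _ := ENNReal.rpow_le_rpow (hN y) hρ.le
      _ = C ^ ρ * ∫⁻ y, A y ^ ρ * B y ^ ρ ∂ν :=
          lintegral_const_mul' _ _ (ENNReal.rpow_ne_top_of_nonneg hρ.le hC)
      _ ≤ C ^ ρ * (a ^ ρ * b ^ ρ) := by gcongr
      _ = _ := by
          rw [← ENNReal.mul_rpow_of_nonneg _ _ hρ.le, ← ENNReal.mul_rpow_of_nonneg _ _ hρ.le]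
  calc ((∫⁻ y, N y ^ γ⁻¹ ∂ν) ^ γ) ^ 2 ≤ (((C * (a * b)) ^ ρ) ^ γ) ^ 2 := by gcongr
    _ = C * (a * b) := by
        rw [← ENNReal.rpow_mul, ← ENNReal.rpow_mul_natCast]
        convert ENNReal.rpow_one _ using 2
        rw [hρd]; push_cast; field_simp

lemma components {U : Set ℝ} (hU : IsOpen U) (hb : Bornology.IsBounded U) :
    ∃ S : Set (Set ℝ), S.Countable ∧ S.PairwiseDisjoint id ∧ (⋃ I ∈ S, I) = U ∧
      ∀ I ∈ S, ∃ a b : ℝ, a < b ∧ I = Set.Ioo a b ∧ a ∉ U ∧ b ∉ U := by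
  set S : Set (Set ℝ) := (fun x => connectedComponentIn U x) '' U with hS
  have hd : S.PairwiseDisjoint id := by
    rintro _ ⟨x, hx, rfl⟩ _ ⟨y, hy, rfl⟩ hne
    rw [Function.onFun, Set.disjoint_left]
    intro z hz1 hz2
    exact hne ((connectedComponentIn_eq hz1).trans (connectedComponentIn_eq hz2).symm)
  refine ⟨S, ?_, hd, ?_, ?_⟩
  · refine hd.countable_of_isOpen ?_ ?_
    · rintro _ ⟨x, hx, rfl⟩; exact hU.connectedComponentIn
    · rintro _ ⟨x, hx, rfl⟩; exact ⟨x, mem_connectedComponentIn hx⟩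
  · ext z
    simp only [Set.mem_iUnion, exists_prop]
    constructor
    · rintro ⟨_, ⟨x, hx, rfl⟩, hz⟩; exact connectedComponentIn_subset _ _ hz
    · intro hz; exact ⟨_, ⟨z, hz, rfl⟩, mem_connectedComponentIn hz⟩
  · rintro _ ⟨x, hx, rfl⟩
    simp only
    set I := connectedComponentIn U x with hI
    have hxI : x ∈ I := mem_connectedComponentIn hx
    have hIU : I ⊆ U := connectedComponentIn_subset _ _
    have hIo : IsOpen I := hU.connectedComponentIn
    have hIc : IsConnected I := isConnected_connectedComponentIn_iff.2 hx
    have hIb : Bornology.IsBounded I := hb.subset hIU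
    have hsub := hIc.Ioo_csInf_csSup_subset hIb.bddBelow hIb.bddAbove
    have hlt : ∀ z ∈ I, sInf I < z ∧ z < sSup I := by
      intro z hz
      obtain ⟨ε, hε, hball⟩ := Metric.isOpen_iff.1 hIo z hz
      have h1 : z - ε / 2 ∈ I := hball (by simp [abs_of_pos hε]; exact hε)
      have h2 : z + ε / 2 ∈ I := hball (by simp [abs_of_pos hε]; exact hε)
      exact ⟨by linarith [csInf_le hIb.bddBelow h1], by linarith [le_csSup hIb.bddAbove h2]⟩
    have heq : I = Set.Ioo (sInf I) (sSup I) := Set.Subset.antisymm (fun z hz => hlt z hz) hsub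
    refine ⟨sInf I, sSup I, (hlt x hxI).1.trans (hlt x hxI).2, heq, ?_, ?_⟩
    · intro ha
      have h1 : Set.Ico (sInf I) (sSup I) ⊆ U := by
        intro z hz
        rcases hz.1.eq_or_lt with h | h
        · rwa [← h]
        · exact hIU (hsub ⟨h, hz.2⟩)
      have h2 : Set.Ico (sInf I) (sSup I) ⊆ I := isPreconnected_Ico.subset_connectedComponentIn
        ⟨(hlt x hxI).1.le, (hlt x hxI).2⟩ h1
      exact lt_irrefl _ (hlt _ (h2 ⟨le_rfl, (hlt x hxI).1.trans (hlt x hxI).2⟩)).1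
    · intro ha
      have h1 : Set.Ioc (sInf I) (sSup I) ⊆ U := by
        intro z hz
        rcases hz.2.eq_or_lt with h | h
        · rwa [h]
        · exact hIU (hsub ⟨hz.1, h⟩)
      have h2 : Set.Ioc (sInf I) (sSup I) ⊆ I := isPreconnected_Ioc.subset_connectedComponentIn
        ⟨(hlt x hxI).1, (hlt x hxI).2.le⟩ h1
      exact lt_irrefl _ (hlt _ (h2 ⟨(hlt x hxI).1.trans (hlt x hxI).2, le_rfl⟩)).2

lemma line_norm {u v w : ℝ → ℝ} (hu : ∀ t, HasDerivAt u (v t) t) (hv : ∀ t, HasDerivAt v (w t) t)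
    (hw : Continuous w) (hb : HasCompactSupport v) {α β γ : ℝ} (hα : 0 ≤ α) (hα1 : α ≤ 1)
    (hβ : 0 ≤ β) (hβ1 : β ≤ 1) (hγ : 2 * γ = α + β) :
    eLpNorm v (P γ) volume ^ 2 ≤ 64 * (eLpNorm u (P α) volume * eLpNorm w (P β) volume) := by
  have hvc : Continuous v := continuous_iff_continuousAt.2 fun t => (hv t).continuousAt
  have hUo : IsOpen (Function.support v) := hvc.isOpen_support
  obtain ⟨S, hSc, hSd, hSU, hSI⟩ := components hUo
    (hb.isCompact.isBounded.subset (subset_tsupport v))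
  have hSm : ∀ I ∈ S, MeasurableSet I := by
    intro I hI
    obtain ⟨a, b, -, rfl, -⟩ := hSI I hI
    exact measurableSet_Ioo
  have hloc : ∀ I ∈ S, eLpNorm v (P γ) (volume.restrict I) ^ 2 ≤
      64 * (eLpNorm u (P α) (volume.restrict I) * eLpNorm w (P β) (volume.restrict I)) := by
    intro I hI
    obtain ⟨a, b, hab, rfl, ha, hb'⟩ := hSI I hI
    refine loc_norm hu hv hw hab (by simpa using hb') (by simpa using ha) ?_ hα hα1 hβ hβ1 hγ
    intro t ht
    have : t ∈ Function.support v := by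
      rw [← hSU]; exact Set.mem_biUnion hI ht
    exact this
  have hγ0 : 0 ≤ γ := by linarith
  rcases hγ0.eq_or_lt with h | h
  · have key : eLpNorm v (P γ) volume ≤
        (64 * (eLpNorm u (P α) volume * eLpNorm w (P β) volume)) ^ (2 : ℝ)⁻¹ := by
      rw [← h, P_zero, eLpNorm_exponent_top]
      refine eLpNormEssSup_le_of_ae_enorm_bound ?_
      have h1 : ∀ᵐ t ∂(volume.restrict (⋃ I ∈ S, I)), ‖v t‖ₑ ≤
          (64 * (eLpNorm u (P α) volume * eLpNorm w (P β) volume)) ^ (2 : ℝ)⁻¹ := by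
        rw [ae_restrict_biUnion_iff _ hSc]
        intro I hI
        have h2 := hloc I hI
        rw [← h, P_zero, eLpNorm_exponent_top] at h2
        filter_upwards [enorm_ae_le_eLpNormEssSup v (volume.restrict I)] with t ht
        rw [ENNReal.le_rpow_inv_iff (by norm_num), ENNReal.rpow_two]
        refine (pow_le_pow_left' ht 2).trans (h2.trans ?_)
        gcongr <;> exact Measure.restrict_le_self
      rw [hSU, ae_restrict_iff' hUo.measurableSet] at h1
      filter_upwards [h1] with t ht
      by_cases h0 : v t = 0
      · simp [h0]
      · exact ht h0
    calc eLpNorm v (P γ) volume ^ 2 ≤ _ := pow_le_pow_left' key 2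
      _ = _ := by
        rw [← ENNReal.rpow_mul_natCast]; norm_num
  · let _ : MeasurableSpace S := ⊤
    have hsum : ∀ F : ℝ → ℝ≥0∞, ∫⁻ I : S, (∫⁻ t in (I : Set ℝ), F t) ∂Measure.count =
        ∫⁻ t in Function.support v, F t := by
      intro F
      rw [lintegral_count, ← hSU, lintegral_biUnion hSc hSm hSd]
    have hpow : ∀ {c : ℝ}, 0 < c → ∀ (f : ℝ → ℝ) (μ : Measure ℝ),
        eLpNorm f (P c) μ ^ c⁻¹ = ∫⁻ t, ‖f t‖ₑ ^ c⁻¹ ∂μ := by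
      intro c hc f μ
      rw [eLpNorm_P hc, ← ENNReal.rpow_mul, mul_inv_cancel₀ hc.ne', ENNReal.rpow_one]
    have := holder_glue (Y := S) (ν := Measure.count)
      (N := fun I => eLpNorm v (P γ) (volume.restrict (I : Set ℝ)))
      (A := fun I => eLpNorm u (P α) (volume.restrict (I : Set ℝ)))
      (B := fun I => eLpNorm w (P β) (volume.restrict (I : Set ℝ)))
      (a := eLpNorm u (P α) volume) (b := eLpNorm w (P β) volume) (C := 64)
      measurable_from_top.aemeasurable measurable_from_top.aemeasurable (by norm_num)
      (fun I => hloc I I.2) hα hβ h hγ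
      (fun _ I => eLpNorm_mono_measure _ Measure.restrict_le_self)
      (fun hc => by
        simp only [hpow hc]
        rw [hsum]
        exact lintegral_mono' Measure.restrict_le_self le_rfl)
      (fun _ I => eLpNorm_mono_measure _ Measure.restrict_le_self)
      (fun hc => by
        simp only [hpow hc]
        rw [hsum]
        exact lintegral_mono' Measure.restrict_le_self le_rfl)
    simp only [hpow h] at this
    rw [hsum] at this
    refine le_trans (le_of_eq ?_) this
    rw [eLpNorm_P h]
    congr 2
    rw [← lintegral_indicator hUo.measurableSet]
    refine lintegral_congr fun t => ?_
    by_cases h0 : v t = 0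
    · simp [h0, h]
    · rw [Set.indicator_of_mem (by exact h0)]

abbrev E3 := EuclideanSpace ℝ (Fin 3)

noncomputable def sl (i : Fin 3) (y : Fin 2 → ℝ) (t : ℝ) : E3 :=
  WithLp.toLp 2 (i.insertNth (α := fun _ => ℝ) t y)

lemma sl_eq (i : Fin 3) (y : Fin 2 → ℝ) (t : ℝ) :
    sl i y t = sl i y 0 + t • EuclideanSpace.single i (1 : ℝ) := by
  ext j
  refine Fin.succAboveCases i ?_ (fun k => ?_) j
  · simp [sl]
  · simp [sl]

lemma sl_hasDerivAt (i : Fin 3) (y : Fin 2 → ℝ) (t : ℝ) :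
    HasDerivAt (sl i y) (EuclideanSpace.single i (1 : ℝ)) t := by
  have h : HasDerivAt (fun t : ℝ => sl i y 0 + t • EuclideanSpace.single i (1 : ℝ))
      ((1 : ℝ) • EuclideanSpace.single i (1 : ℝ)) t :=
    ((hasDerivAt_id t).smul_const _).const_add _
  rw [one_smul] at h
  exact h.congr_of_eventuallyEq (Filter.Eventually.of_forall fun t => sl_eq i y t)

lemma sl_surj (i : Fin 3) (x : E3) : ∃ y t, sl i y t = x := by
  refine ⟨i.removeNth (α := fun _ => ℝ) (WithLp.ofLp x), x i, ?_⟩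
  simp [sl]

lemma sl_measurePreserving (i : Fin 3) :
    MeasurePreserving (fun z : ℝ × (Fin 2 → ℝ) => sl i z.2 z.1) := by
  have h1 := (volume_preserving_piFinSuccAbove (fun _ : Fin 3 => ℝ) i).symm
  exact (PiLp.volume_preserving_toLp (Fin 3)).comp h1

lemma lint_slice (i : Fin 3) {F : E3 → ℝ≥0∞} (hF : Measurable F) :
    ∫⁻ x, F x = ∫⁻ y : Fin 2 → ℝ, ∫⁻ t : ℝ, F (sl i y t) := by
  have h := sl_measurePreserving i
  rw [← h.lintegral_comp hF, Measure.volume_eq_prod]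
  exact lintegral_prod_symm' _ (hF.comp h.measurable)

lemma enorm_le_top {F X : Type*} [NormedAddCommGroup F] [TopologicalSpace X] [MeasurableSpace X]
    {μ : Measure X} [μ.IsOpenPosMeasure]
    {f : X → F} (hf : Continuous f) (x : X) : ‖f x‖ₑ ≤ eLpNorm f ⊤ μ := by
  by_contra! h
  have ho : IsOpen {y | eLpNorm f ⊤ μ < ‖f y‖ₑ} :=
    isOpen_lt continuous_const hf.enorm
  have h0 : μ {y | eLpNorm f ⊤ μ < ‖f y‖ₑ} = 0 := by
    have := enorm_ae_le_eLpNormEssSup f μ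
    rw [ae_iff] at this
    simpa [eLpNorm_exponent_top] using this
  have := (ho.measure_eq_zero_iff μ).1 h0
  exact (this ▸ h : x ∈ (∅ : Set X))

lemma dir_norm (i : Fin 3) {u v w : E3 → ℝ} (huc : Continuous u)
    (hu : ∀ y t, HasDerivAt (fun t => u (sl i y t)) (v (sl i y t)) t) (hvc : Continuous v)
    (hv : ∀ y t, HasDerivAt (fun t => v (sl i y t)) (w (sl i y t)) t)
    (hw : Continuous w) (hb : HasCompactSupport v) {α β γ : ℝ} (hα : 0 ≤ α) (hα1 : α ≤ 1)
    (hβ : 0 ≤ β) (hβ1 : β ≤ 1) (hγ : 2 * γ = α + β) :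
    eLpNorm v (P γ) volume ^ 2 ≤ 64 * (eLpNorm u (P α) volume * eLpNorm w (P β) volume) := by
  have hslc : ∀ y, Continuous (sl i y) := fun y =>
    continuous_iff_continuousAt.2 fun t => (sl_hasDerivAt i y t).continuousAt
  have hloc : ∀ y, eLpNorm (fun t => v (sl i y t)) (P γ) volume ^ 2 ≤
      64 * (eLpNorm (fun t => u (sl i y t)) (P α) volume *
        eLpNorm (fun t => w (sl i y t)) (P β) volume) := by
    intro y
    refine line_norm (hu y) (hv y) (hw.comp (hslc y)) ?_ hα hα1 hβ hβ1 hγ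
    obtain ⟨R, hR⟩ := hb.isCompact.isBounded.exists_norm_le
    refine HasCompactSupport.intro (isCompact_Icc (a := -R) (b := R)) fun t ht => ?_
    by_contra hne
    apply ht
    have h1 := hR _ (subset_tsupport v hne)
    have h2 := PiLp.norm_apply_le (sl i y t) i
    have h3 : (sl i y t) i = t := by simp [sl]
    rw [h3, Real.norm_eq_abs] at h2
    exact abs_le.1 (h2.trans h1)
  have hγ0 : 0 ≤ γ := by linarith
  have hsup : ∀ {f : E3 → ℝ}, Continuous f → ∀ y,
      eLpNorm (fun t => f (sl i y t)) ⊤ volume ≤ eLpNorm f ⊤ volume := by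
    intro f hf y
    conv_lhs => rw [eLpNorm_exponent_top]
    exact eLpNormEssSup_le_of_ae_enorm_bound (Filter.Eventually.of_forall
      fun t => enorm_le_top hf _)
  rcases hγ0.eq_or_lt with h | h
  · have hα0 : α = 0 := by linarith
    have hβ0 : β = 0 := by linarith
    subst hα0 hβ0
    rw [← h] at hloc ⊢
    simp only [P_zero] at hloc ⊢
    have key : eLpNorm v ⊤ volume ≤
        (64 * (eLpNorm u ⊤ volume * eLpNorm w ⊤ volume)) ^ (2 : ℝ)⁻¹ := by
      conv_lhs => rw [eLpNorm_exponent_top]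
      refine eLpNormEssSup_le_of_ae_enorm_bound (Filter.Eventually.of_forall fun x => ?_)
      obtain ⟨y, t, rfl⟩ := sl_surj i x
      rw [ENNReal.le_rpow_inv_iff (by norm_num), ENNReal.rpow_two]
      refine (pow_le_pow_left' (enorm_le_top (μ := volume) (hvc.comp (hslc y)) t) 2).trans
        ((hloc y).trans ?_)
      gcongr
      · exact hsup huc y
      · exact hsup hw y
    calc eLpNorm v ⊤ volume ^ 2 ≤ _ := pow_le_pow_left' key 2
      _ = _ := by
        rw [← ENNReal.rpow_mul_natCast]; norm_num
  · have hpow : ∀ {c : ℝ}, 0 < c → ∀ (f : ℝ → ℝ) (μ : Measure ℝ),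
        eLpNorm f (P c) μ ^ c⁻¹ = ∫⁻ t, ‖f t‖ₑ ^ c⁻¹ ∂μ := by
      intro c hc f μ
      rw [eLpNorm_P hc, ← ENNReal.rpow_mul, mul_inv_cancel₀ hc.ne', ENNReal.rpow_one]
    have hpow3 : ∀ {c : ℝ}, 0 < c → ∀ (f : E3 → ℝ) (μ : Measure E3),
        eLpNorm f (P c) μ ^ c⁻¹ = ∫⁻ t, ‖f t‖ₑ ^ c⁻¹ ∂μ := by
      intro c hc f μ
      rw [eLpNorm_P hc, ← ENNReal.rpow_mul, mul_inv_cancel₀ hc.ne', ENNReal.rpow_one]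
    have hsum : ∀ {c : ℝ}, 0 < c → ∀ {f : E3 → ℝ}, Continuous f →
        ∫⁻ y, eLpNorm (fun t => f (sl i y t)) (P c) volume ^ c⁻¹ = 
          eLpNorm f (P c) volume ^ c⁻¹ := by
      intro c hc f hf
      simp only [hpow hc]
      rw [hpow3 hc, lint_slice i]
      exact (hf.measurable.enorm.pow_const _)
    have hmeas : ∀ {c : ℝ}, 0 < c → ∀ {f : E3 → ℝ}, Continuous f →
        Measurable (fun y => eLpNorm (fun t => f (sl i y t)) (P c) volume) := by
      intro c hc f hf
      simp only [eLpNorm_P hc]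
      refine Measurable.pow_const ?_ _
      have := (hf.measurable.enorm.pow_const c⁻¹).comp (sl_measurePreserving i).measurable
      exact Measurable.lintegral_prod_left' this
    have hmeas' : ∀ {c : ℝ}, 0 ≤ c → ∀ {f : E3 → ℝ}, Continuous f → ∃ A : (Fin 2 → ℝ) → ℝ≥0∞,
        Measurable A ∧ (∀ y, eLpNorm (fun t => f (sl i y t)) (P c) volume ≤ A y) ∧
        (c = 0 → ∀ y, A y ≤ eLpNorm f (P c) volume) ∧
        (0 < c → ∫⁻ y, A y ^ c⁻¹ ≤ eLpNorm f (P c) volume ^ c⁻¹) := by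
      intro c hc f hf
      rcases hc.eq_or_lt with h0 | h0
      · subst h0
        refine ⟨fun _ => eLpNorm f (P 0) volume, measurable_const, fun y => ?_, fun _ y => le_rfl,
          fun h => absurd h (lt_irrefl _)⟩
        rw [P_zero]; exact hsup hf y
      · exact ⟨_, hmeas h0 hf, fun y => le_rfl, fun h => absurd h h0.ne', fun _ => (hsum h0 hf).le⟩
    obtain ⟨A, hA, hA1, hA2, hA3⟩ := hmeas' hα huc
    obtain ⟨B, hB, hB1, hB2, hB3⟩ := hmeas' hβ hw
    have := holder_glue (ν := (volume : Measure (Fin 2 → ℝ)))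
      (N := fun y => eLpNorm (fun t => v (sl i y t)) (P γ) volume)
      (C := 64) hA.aemeasurable hB.aemeasurable (by norm_num)
      (fun y => (hloc y).trans (by gcongr; exacts [hA1 y, hB1 y])) hα hβ h hγ hA2 hA3 hB2 hB3
    rw [hsum h hvc, ← ENNReal.rpow_mul, inv_mul_cancel₀ h.ne', ENNReal.rpow_one] at this
    exact this

lemma opnorm_le (k : ℕ) (T : ContinuousMultilinearMap ℝ (fun _ : Fin k => E3) ℝ) :
    ‖T‖ ≤ ∑ I : Fin k → Fin 3, ‖T (fun j => EuclideanSpace.single (I j) (1 : ℝ))‖ := by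
  refine T.opNorm_le_bound (Finset.sum_nonneg fun _ _ => norm_nonneg _) fun m => ?_
  have hm : m = fun j => ∑ i : Fin 3, (m j i) • EuclideanSpace.single i (1 : ℝ) := by
    funext j
    ext l
    simp [Finset.sum_apply, Pi.single_apply]
  conv_lhs => rw [hm]
  rw [T.map_sum, Finset.sum_mul]
  refine (norm_sum_le _ _).trans (Finset.sum_le_sum fun I _ => ?_)
  rw [T.map_smul_univ (fun j => m j (I j)), norm_smul, mul_comm, norm_prod]
  gcongr with j
  exact PiLp.norm_apply_le _ _

lemma deriv_slice {f : E3 → ℝ} (hf : ContDiff ℝ (⊤ : ℕ∞) f) (k : ℕ) (i : Fin 3)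
    (e : Fin k → E3) (y : Fin 2 → ℝ) (t : ℝ) :
    HasDerivAt (fun t => iteratedFDeriv ℝ k f (sl i y t) e)
      (iteratedFDeriv ℝ (k + 1) f (sl i y t) (Fin.cons (EuclideanSpace.single i (1 : ℝ)) e)) t := by
  have h1 : Differentiable ℝ (iteratedFDeriv ℝ k f) :=
    hf.differentiable_iteratedFDeriv (by exact_mod_cast ENat.natCast_lt_top k)
  have h2 := (h1 (sl i y t)).hasFDerivAt.comp_hasDerivAt t (sl_hasDerivAt i y t)
  have h3 := (ContinuousMultilinearMap.apply ℝ (fun _ : Fin k => E3) ℝ e).hasFDerivAt.comp_hasDerivAt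
    t h2
  rw [iteratedFDeriv_succ_apply_left]
  simp only [Fin.cons_zero, Fin.tail_cons]
  exact h3

lemma step {f : E3 → ℝ} (hf : ContDiff ℝ (⊤ : ℕ∞) f) (hc : HasCompactSupport f) (k : ℕ)
    {α β γ : ℝ} (hα : 0 ≤ α) (hα1 : α ≤ 1)
    (hβ : 0 ≤ β) (hβ1 : β ≤ 1) (hγ : 2 * γ = α + β) :
    eLpNorm (iteratedFDeriv ℝ (k + 1) f) (P γ) volume ^ 2 ≤
      ((3 : ℝ≥0∞) ^ (k + 1)) ^ 2 * (64 * (eLpNorm (iteratedFDeriv ℝ k f) (P α) volume *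
        eLpNorm (iteratedFDeriv ℝ (k + 2) f) (P β) volume)) := by
  set Z := 64 * (eLpNorm (iteratedFDeriv ℝ k f) (P α) volume *
        eLpNorm (iteratedFDeriv ℝ (k + 2) f) (P β) volume) with hZ
  have hcont : ∀ n, Continuous (iteratedFDeriv ℝ n f) := fun n =>
    hf.continuous_iteratedFDeriv (by exact_mod_cast le_top)
  have hcont' : ∀ n (e : Fin n → E3), Continuous (fun x => iteratedFDeriv ℝ n f x e) := fun n e =>
    (ContinuousMultilinearMap.apply ℝ (fun _ : Fin n => E3) ℝ e).continuous.comp (hcont n)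
  have hle : ∀ n (e : Fin n → E3), (∀ j, ‖e j‖ = 1) → ∀ q, 
      eLpNorm (fun x => iteratedFDeriv ℝ n f x e) q volume ≤
        eLpNorm (iteratedFDeriv ℝ n f) q volume := by
    intro n e he q
    refine eLpNorm_mono fun x => ?_
    refine (ContinuousMultilinearMap.le_opNorm _ _).trans ?_
    simp [he]
  have hterm : ∀ I : Fin (k + 1) → Fin 3,
      eLpNorm (fun x => iteratedFDeriv ℝ (k + 1) f x
        (fun j => EuclideanSpace.single (I j) (1 : ℝ))) (P γ) volume ≤ Z ^ (2 : ℝ)⁻¹ := by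
    intro I
    rw [ENNReal.le_rpow_inv_iff (by norm_num), ENNReal.rpow_two]
    set i := I 0
    set e : Fin k → E3 := fun j => EuclideanSpace.single (I j.succ) (1 : ℝ) with he
    have hI : (fun j => EuclideanSpace.single (I j) (1 : ℝ)) =
        (Fin.cons (EuclideanSpace.single i (1 : ℝ)) e : Fin (k + 1) → E3) := by
      funext j
      refine Fin.cases ?_ (fun l => ?_) j <;> simp [i, he]
    rw [hI]
    refine (dir_norm i (u := fun x => iteratedFDeriv ℝ k f x e)
      (w := fun x => iteratedFDeriv ℝ (k + 2) f x (Fin.cons (EuclideanSpace.single i (1 : ℝ))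
        (Fin.cons (EuclideanSpace.single i (1 : ℝ)) e : Fin (k + 1) → E3)))
      (hcont' _ _) (fun y t => deriv_slice hf k i e y t) (hcont' _ _)
      (fun y t => deriv_slice hf (k + 1) i _ y t) (hcont' _ _) ?_ hα hα1 hβ hβ1 hγ).trans ?_
    · exact (hc.iteratedFDeriv (𝕜 := ℝ) (k + 1)).comp_left
        (g := fun T : ContinuousMultilinearMap ℝ (fun _ : Fin (k + 1) => E3) ℝ => T _) rfl
    · rw [hZ]
      gcongr
      · exact hle _ _ (fun j => by simp [he]) _
      · refine hle _ _ (fun j => ?_) _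
        refine Fin.cases ?_ (fun l => ?_) j
        · simp
        · refine Fin.cases ?_ (fun l => ?_) l <;> simp [he]
  have hmain : eLpNorm (iteratedFDeriv ℝ (k + 1) f) (P γ) volume ≤
      (3 : ℝ≥0∞) ^ (k + 1) * Z ^ (2 : ℝ)⁻¹ := by
    calc eLpNorm (iteratedFDeriv ℝ (k + 1) f) (P γ) volume
        ≤ eLpNorm (∑ I : Fin (k + 1) → Fin 3, fun x => ‖iteratedFDeriv ℝ (k + 1) f x
          (fun j => EuclideanSpace.single (I j) (1 : ℝ))‖) (P γ) volume := by
          refine eLpNorm_mono_real fun x => ?_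
          rw [Finset.sum_apply]
          exact opnorm_le _ _
      _ ≤ ∑ I : Fin (k + 1) → Fin 3, eLpNorm (fun x => ‖iteratedFDeriv ℝ (k + 1) f x
          (fun j => EuclideanSpace.single (I j) (1 : ℝ))‖) (P γ) volume :=
          eLpNorm_sum_le (fun I _ => (hcont' _ _).norm.aestronglyMeasurable)
            (one_le_P (by linarith))
      _ ≤ ∑ I : Fin (k + 1) → Fin 3, Z ^ (2 : ℝ)⁻¹ := by
          refine Finset.sum_le_sum fun I _ => ?_
          rw [eLpNorm_norm]
          exact hterm I
      _ = _ := by simp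
  calc eLpNorm (iteratedFDeriv ℝ (k + 1) f) (P γ) volume ^ 2 ≤ _ := pow_le_pow_left' hmain 2
    _ = _ := by
      rw [mul_pow]
      congr 1
      rw [← ENNReal.rpow_mul_natCast]; norm_num

lemma chain1 {C : ℝ} (hC : 1 ≤ C) (n : ℕ) : ∃ K : ℝ, 1 ≤ K ∧ ∀ A : ℕ → ℝ, (∀ k, 0 ≤ A k) →
    (∀ k < n, A (k + 1) ^ 2 ≤ C * (A k * A (k + 2))) →
    A n ^ (n + 1) ≤ K * (A 0 * A (n + 1) ^ n) := by
  induction n with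
  | zero => exact ⟨1, le_rfl, fun A _ _ => by simp⟩
  | succ n ih =>
    obtain ⟨K, hK, h⟩ := ih
    refine ⟨C ^ (n + 1) * K, one_le_mul_of_one_le_of_one_le (one_le_pow₀ hC) hK,
      fun A hA hA2 => ?_⟩
    have h1 := h A hA (fun k hk => hA2 k (by omega))
    have h2 := hA2 n (by omega)
    have hC0 : 0 ≤ C := by linarith
    have hK0 : 0 ≤ K := by linarith
    rcases (hA (n + 1)).eq_or_lt with h0 | h0
    · rw [← h0, zero_pow (by omega)]
      have := hA 0; have := hA (n + 1 + 1); positivity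
    · refine le_of_mul_le_mul_right ?_ (pow_pos h0 n)
      calc A (n + 1) ^ (n + 1 + 1) * A (n + 1) ^ n = (A (n + 1) ^ 2) ^ (n + 1) := by ring
        _ ≤ (C * (A n * A (n + 2))) ^ (n + 1) := by gcongr
        _ = C ^ (n + 1) * A n ^ (n + 1) * A (n + 2) ^ (n + 1) := by ring
        _ ≤ C ^ (n + 1) * (K * (A 0 * A (n + 1) ^ n)) * A (n + 2) ^ (n + 1) := by
            have := hA (n + 2)
            gcongr
        _ = _ := by ring

lemma chain2 {C : ℝ} (hC : 1 ≤ C) (j m : ℕ) (hjm : j ≤ m) :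
    ∃ K : ℝ, 1 ≤ K ∧ ∀ A : ℕ → ℝ, (∀ k, 0 ≤ A k) →
    (∀ k, k + 2 ≤ m → A (k + 1) ^ 2 ≤ C * (A k * A (k + 2))) →
    A j ^ m ≤ K * (A 0 ^ (m - j) * A m ^ j) := by
  induction m, hjm using Nat.le_induction with
  | base => exact ⟨1, le_rfl, fun A _ _ => by simp⟩
  | succ m hm ih =>
    obtain ⟨K, hK, h⟩ := ih
    obtain ⟨L, hL, h'⟩ := chain1 hC m
    rcases Nat.eq_zero_or_pos m with rfl | hm0
    · obtain rfl : j = 0 := by omega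
      exact ⟨1, le_rfl, fun A _ _ => by simp⟩
    obtain ⟨d, rfl⟩ := Nat.exists_eq_add_of_le hm
    have hKL : 1 ≤ K ^ (j + d + 1) * L ^ j :=
      one_le_mul_of_one_le_of_one_le (one_le_pow₀ hK) (one_le_pow₀ hL)
    refine ⟨K ^ (j + d + 1) * L ^ j, hKL, fun A hA hA2 => ?_⟩
    have h1 := h A hA (fun k hk => hA2 k (by omega))
    have h2 := h' A hA (fun k hk => hA2 k (by omega))
    have e1 : j + d - j = d := by omega
    have e2 : j + d + 1 - j = d + 1 := by omega
    rw [e1] at h1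
    rw [e2]
    have a0 := hA 0; have a1 := hA j; have a2 := hA (j + d); have a3 := hA (j + d + 1)
    have hK0 : 0 ≤ K := by linarith
    have hL0 : 0 ≤ L := by linarith
    refine le_of_pow_le_pow_left₀ hm0.ne' (by positivity) ?_
    calc (A j ^ (j + d + 1)) ^ (j + d) = (A j ^ (j + d)) ^ (j + d + 1) := by ring
      _ ≤ (K * (A 0 ^ d * A (j + d) ^ j)) ^ (j + d + 1) := by gcongr
      _ = K ^ (j + d + 1) * A 0 ^ (d * (j + d + 1)) * (A (j + d) ^ (j + d + 1)) ^ j := by ring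
      _ ≤ K ^ (j + d + 1) * A 0 ^ (d * (j + d + 1)) * (L * (A 0 * A (j + d + 1) ^ (j + d))) ^ j := by
          gcongr
      _ = (K ^ (j + d + 1) * L ^ j) * (A 0 ^ (d + 1) * A (j + d + 1) ^ j) ^ (j + d) := by ring
      _ ≤ (K ^ (j + d + 1) * L ^ j) ^ (j + d) * (A 0 ^ (d + 1) * A (j + d + 1) ^ j) ^ (j + d) := by
          gcongr
          exact le_self_pow₀ hKL hm0.ne'
      _ = _ := by rw [← mul_pow]

lemma fin_norm {f : E3 → ℝ} (hf : ContDiff ℝ (⊤ : ℕ∞) f) (hc : HasCompactSupport f) (k : ℕ)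
    (q : ℝ≥0∞) : eLpNorm (iteratedFDeriv ℝ k f) q volume ≠ ⊤ :=
  ((hf.continuous_iteratedFDeriv (by exact_mod_cast le_top)).memLp_of_hasCompactSupport
    (hc.iteratedFDeriv (𝕜 := ℝ) k)).eLpNorm_ne_top

lemma gn (m j : ℕ) (hm : 1 ≤ m) (hj : j ≤ m) {α β : ℝ} (hα : 0 ≤ α) (hα1 : α ≤ 1)
    (hβ : 0 ≤ β) (hβ1 : β ≤ 1) : ∃ K : ℝ, 1 ≤ K ∧ ∀ f : E3 → ℝ,
      ContDiff ℝ (⊤ : ℕ∞) f → HasCompactSupport f →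
      (eLpNorm (iteratedFDeriv ℝ j f) (P ((1 - (j / m : ℝ)) * α + (j / m : ℝ) * β)) volume).toReal ^ m
        ≤ K * ((eLpNorm f (P α) volume).toReal ^ (m - j) *
          (eLpNorm (iteratedFDeriv ℝ m f) (P β) volume).toReal ^ j) := by
  have hC : (1 : ℝ) ≤ ((3 : ℝ) ^ m) ^ 2 * 64 := by
    have : (1 : ℝ) ≤ ((3 : ℝ) ^ m) ^ 2 := one_le_pow₀ (one_le_pow₀ (by norm_num))
    linarith
  obtain ⟨K, hK, h⟩ := chain2 hC j m hj
  refine ⟨K, hK, fun f hf hc => ?_⟩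
  have hm0 : (0 : ℝ) < m := by exact_mod_cast hm
  set θ : ℕ → ℝ := fun k => (1 - (k / m : ℝ)) * α + (k / m : ℝ) * β with hθ
  have hθ01 : ∀ k ≤ m, 0 ≤ θ k ∧ θ k ≤ 1 := by
    intro k hk
    have h1 : (k / m : ℝ) ≤ 1 := by
      rw [div_le_one hm0]; exact_mod_cast hk
    have h0 : 0 ≤ (k / m : ℝ) := by positivity
    have h2 : 0 ≤ 1 - (k / m : ℝ) := by linarith
    refine ⟨by positivity, ?_⟩
    have := mul_le_mul_of_nonneg_left hα1 h2
    have := mul_le_mul_of_nonneg_left hβ1 h0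
    simp only [hθ]
    linarith
  have := h (fun k => (eLpNorm (iteratedFDeriv ℝ k f) (P (θ k)) volume).toReal)
    (fun k => ENNReal.toReal_nonneg) ?_
  · have e0 : θ 0 = α := by simp [hθ]
    have em : θ m = β := by simp [hθ, hm0.ne']
    simp only [e0, em] at this
    have e1 : eLpNorm (iteratedFDeriv ℝ 0 f) (P α) volume = eLpNorm f (P α) volume :=
      eLpNorm_congr_norm_ae (Filter.Eventually.of_forall fun x => norm_iteratedFDeriv_zero)
    rw [e1] at this
    exact this
  · intro k hk
    have h1 := step hf hc k (hθ01 k (by omega)).1 (hθ01 k (by omega)).2 (hθ01 (k + 2) hk).1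
      (hθ01 (k + 2) hk).2 (γ := θ (k + 1)) (by simp only [hθ]; push_cast; ring)
    have h2 := ENNReal.toReal_mono (by
      refine ENNReal.mul_ne_top (by finiteness) (ENNReal.mul_ne_top (by norm_num)
        (ENNReal.mul_ne_top (fin_norm hf hc _ _) (fin_norm hf hc _ _)))) h1
    simp only [ENNReal.toReal_mul, ENNReal.toReal_pow, ENNReal.toReal_ofNat] at h2
    refine h2.trans ?_
    rw [← mul_assoc]
    gcongr
    · norm_num
    · omega

lemma term_le (m i : ℕ) (hm : 1 ≤ m) (hi : i ≤ m) {a a₁ a₂ a₃ a₄ : ℝ}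
    (h1 : 0 ≤ a₁) (h1' : a₁ ≤ 1) (h2 : 0 ≤ a₂) (h2' : a₂ ≤ 1) (h3 : 0 ≤ a₃) (h3' : a₃ ≤ 1)
    (h4 : 0 ≤ a₄) (h4' : a₄ ≤ 1) (h12 : a = a₁ + a₂) (h34 : a = a₃ + a₄) :
    ∃ K : ℝ, 1 ≤ K ∧ ∀ f g : E3 → ℝ,
      ContDiff ℝ (⊤ : ℕ∞) f → HasCompactSupport f → ContDiff ℝ (⊤ : ℕ∞) g → HasCompactSupport g →
      eLpNorm (fun x => ‖iteratedFDeriv ℝ i f x‖ * ‖iteratedFDeriv ℝ (m - i) g x‖) (P a) volume ≤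
        ENNReal.ofReal K * (eLpNorm f (P a₁) volume * eLpNorm (iteratedFDeriv ℝ m g) (P a₂) volume
          + eLpNorm (iteratedFDeriv ℝ m f) (P a₃) volume * eLpNorm g (P a₄) volume) := by
  obtain ⟨K, hK, hf⟩ := gn m i hm hi h1 h1' h3 h3'
  obtain ⟨L, hL, hg⟩ := gn m (m - i) hm (Nat.sub_le _ _) h4 h4' h2 h2'
  have hKL : 1 ≤ K * L := one_le_mul_of_one_le_of_one_le hK hL
  refine ⟨K * L, hKL, fun f g cf sf cg sg => ?_⟩
  have hm0 : (0 : ℝ) < m := by exact_mod_cast hm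
  have hF := hf f cf sf
  have hG := hg g cg sg
  set s := (1 - (i / m : ℝ)) * a₁ + (i / m : ℝ) * a₃ with hs
  set t := (1 - ((m - i : ℕ) / m : ℝ)) * a₄ + ((m - i : ℕ) / m : ℝ) * a₂ with ht
  have q0 : 0 ≤ (i / m : ℝ) := by positivity
  have q1 : 0 ≤ 1 - (i / m : ℝ) := by
    rw [sub_nonneg, div_le_one hm0]; exact_mod_cast hi
  have q2 : ((m - i : ℕ) / m : ℝ) = 1 - (i / m : ℝ) := by
    rw [Nat.cast_sub hi]; field_simp
  have hs0 : 0 ≤ s := by positivity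
  have ht0 : 0 ≤ t := by
    rw [ht, q2]
    have : 0 ≤ 1 - (1 - (i / m : ℝ)) := by linarith
    positivity
  have hst : s + t = a := by
    have : s + t = (1 - (i / m : ℝ)) * (a₁ + a₂) + (i / m : ℝ) * (a₃ + a₄) := by
      rw [hs, ht, q2]; ring
    rw [this, ← h12, ← h34]; ring
  have hH : (P s).HolderTriple (P t) (P a) := by
    constructor
    simp only [P, inv_inv]
    rw [← ENNReal.ofReal_add hs0 ht0, hst]
  have cont : ∀ {f : E3 → ℝ}, ContDiff ℝ (⊤ : ℕ∞) f → ∀ k, Continuous (iteratedFDeriv ℝ k f) :=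
    fun hf k => hf.continuous_iteratedFDeriv (by exact_mod_cast le_top)
  have hhol := eLpNorm_le_eLpNorm_mul_eLpNorm'_of_norm (μ := volume) (p := P s) (q := P t) (r := P a)
    (f := iteratedFDeriv ℝ i f) (g := iteratedFDeriv ℝ (m - i) g)
    (cont cf i).aestronglyMeasurable (cont cg (m - i)).aestronglyMeasurable
    (fun S T => ‖S‖ * ‖T‖) 1 (Filter.Eventually.of_forall fun x => by simp)
  refine hhol.trans ?_
  have cf0 : eLpNorm f (P a₁) volume ≠ ⊤ :=
    (cf.continuous.memLp_of_hasCompactSupport sf).eLpNorm_ne_top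
  have cg0 : eLpNorm g (P a₄) volume ≠ ⊤ :=
    (cg.continuous.memLp_of_hasCompactSupport sg).eLpNorm_ne_top
  have n1 := fin_norm cf sf i (P s)
  have n2 := fin_norm cg sg (m - i) (P t)
  have n3 := fin_norm cf sf m (P a₃)
  have n4 := fin_norm cg sg m (P a₂)
  rw [ENNReal.coe_one, one_mul, ← ENNReal.toReal_le_toReal (by finiteness) (by finiteness)]
  rw [ENNReal.toReal_mul, ENNReal.toReal_mul, ENNReal.toReal_add (by finiteness) (by finiteness),
    ENNReal.toReal_mul, ENNReal.toReal_mul, ENNReal.toReal_ofReal (by linarith)]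
  have c1 : 0 ≤ (eLpNorm (iteratedFDeriv ℝ i f) (P s) volume).toReal := ENNReal.toReal_nonneg
  have c2 : 0 ≤ (eLpNorm (iteratedFDeriv ℝ (m - i) g) (P t) volume).toReal := ENNReal.toReal_nonneg
  generalize (eLpNorm (iteratedFDeriv ℝ i f) (P s) volume).toReal = x1 at *
  generalize (eLpNorm (iteratedFDeriv ℝ (m - i) g) (P t) volume).toReal = x2 at *
  have b1 : 0 ≤ (eLpNorm f (P a₁) volume).toReal := ENNReal.toReal_nonneg
  have b2 : 0 ≤ (eLpNorm (iteratedFDeriv ℝ m g) (P a₂) volume).toReal := ENNReal.toReal_nonneg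
  have b3 : 0 ≤ (eLpNorm (iteratedFDeriv ℝ m f) (P a₃) volume).toReal := ENNReal.toReal_nonneg
  have b4 : 0 ≤ (eLpNorm g (P a₄) volume).toReal := ENNReal.toReal_nonneg
  generalize (eLpNorm f (P a₁) volume).toReal = y1 at *
  generalize (eLpNorm (iteratedFDeriv ℝ m g) (P a₂) volume).toReal = y2 at *
  generalize (eLpNorm (iteratedFDeriv ℝ m f) (P a₃) volume).toReal = y3 at *
  generalize (eLpNorm g (P a₄) volume).toReal = y4 at *
  rw [Nat.sub_sub_self hi] at hG
  refine le_of_pow_le_pow_left₀ (by omega : m ≠ 0) (by positivity) ?_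
  have hK0 : 0 ≤ K := by linarith
  have hL0 : 0 ≤ L := by linarith
  calc (x1 * x2) ^ m = x1 ^ m * x2 ^ m := mul_pow _ _ _
    _ ≤ (K * (y1 ^ (m - i) * y3 ^ i)) * (L * (y4 ^ i * y2 ^ (m - i))) := by gcongr
    _ = K * L * ((y1 * y2) ^ (m - i) * (y3 * y4) ^ i) := by rw [mul_pow, mul_pow]; ring
    _ ≤ (K * L) ^ m * ((y1 * y2 + y3 * y4) ^ (m - i) * (y1 * y2 + y3 * y4) ^ i) := by
        have : 0 ≤ y1 * y2 := by positivity
        have : 0 ≤ y3 * y4 := by positivity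
        gcongr
        · exact le_self_pow₀ hKL (by omega)
        · linarith
        · linarith
    _ = _ := by rw [← pow_add, Nat.sub_add_cancel hi, ← mul_pow]

end Moser

theorem moser_product_estimate (m : ℕ) (hm : 1 ≤ m)
    (p p₁ p₂ p₃ p₄ : ℝ≥0∞)
    (hp : 1 ≤ p) (hp₁ : 1 ≤ p₁) (hp₂ : 1 ≤ p₂) (hp₃ : 1 ≤ p₃) (hp₄ : 1 ≤ p₄)
    (h12 : 1 / p = 1 / p₁ + 1 / p₂) (h34 : 1 / p = 1 / p₃ + 1 / p₄) :
    ∃ C : ℝ, 0 < C ∧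
      ∀ f g : EuclideanSpace ℝ (Fin 3) → ℝ,
        ContDiff ℝ (⊤ : ℕ∞) f → HasCompactSupport f →
        ContDiff ℝ (⊤ : ℕ∞) g → HasCompactSupport g →
        eLpNorm (iteratedFDeriv ℝ m (fun x => f x * g x)) p volume ≤
          ENNReal.ofReal C *
            (eLpNorm f p₁ volume * eLpNorm (iteratedFDeriv ℝ m g) p₂ volume
              + eLpNorm (iteratedFDeriv ℝ m f) p₃ volume * eLpNorm g p₄ volume) := by
  have hinv : ∀ {q : ℝ≥0∞}, 1 ≤ q → q⁻¹ ≤ 1 := fun h => ENNReal.inv_le_one.2 h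
  have hfin : ∀ {q : ℝ≥0∞}, 1 ≤ q → q⁻¹ ≠ ⊤ := fun h => ((hinv h).trans_lt ENNReal.one_lt_top).ne
  have hP : ∀ {q : ℝ≥0∞}, 1 ≤ q → Moser.P (q⁻¹).toReal = q := by
    intro q h
    rw [Moser.P, ENNReal.ofReal_toReal (hfin h), inv_inv]
  have hle : ∀ {q : ℝ≥0∞}, 1 ≤ q → (q⁻¹).toReal ≤ 1 := fun h => by
    simpa using ENNReal.toReal_mono ENNReal.one_ne_top (hinv h)
  simp only [one_div] at h12 h34
  have r12 := congrArg ENNReal.toReal h12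
  have r34 := congrArg ENNReal.toReal h34
  rw [ENNReal.toReal_add (hfin hp₁) (hfin hp₂)] at r12
  rw [ENNReal.toReal_add (hfin hp₃) (hfin hp₄)] at r34
  have key : ∀ i, ∃ K : ℝ, 1 ≤ K ∧ (i ≤ m → ∀ f g : EuclideanSpace ℝ (Fin 3) → ℝ,
      ContDiff ℝ (⊤ : ℕ∞) f → HasCompactSupport f → ContDiff ℝ (⊤ : ℕ∞) g → HasCompactSupport g →
      eLpNorm (fun x => ‖iteratedFDeriv ℝ i f x‖ * ‖iteratedFDeriv ℝ (m - i) g x‖) p volume ≤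
        ENNReal.ofReal K * (eLpNorm f p₁ volume * eLpNorm (iteratedFDeriv ℝ m g) p₂ volume
          + eLpNorm (iteratedFDeriv ℝ m f) p₃ volume * eLpNorm g p₄ volume)) := by
    intro i
    by_cases hi : i ≤ m
    · obtain ⟨K, hK, h⟩ := Moser.term_le m i hm hi ENNReal.toReal_nonneg (hle hp₁)
        ENNReal.toReal_nonneg (hle hp₂) ENNReal.toReal_nonneg (hle hp₃)
        ENNReal.toReal_nonneg (hle hp₄) r12 r34
      rw [hP hp, hP hp₁, hP hp₂, hP hp₃, hP hp₄] at h
      exact ⟨K, hK, fun _ => h⟩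
    · exact ⟨1, le_rfl, fun h => absurd h hi⟩
  choose K hK hKle using key
  refine ⟨∑ i ∈ Finset.range (m + 1), (m.choose i : ℝ) * K i, ?_, fun f g cf sf cg sg => ?_⟩
  · refine Finset.sum_pos (fun i hi => ?_) ⟨0, by simp⟩
    have h1 : 0 < m.choose i := Nat.choose_pos (by simpa [Nat.lt_succ_iff] using hi)
    have h2 := hK i
    positivity
  have cont : ∀ {f : EuclideanSpace ℝ (Fin 3) → ℝ}, ContDiff ℝ (⊤ : ℕ∞) f →
      ∀ k, Continuous (iteratedFDeriv ℝ k f) :=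
    fun hf k => hf.continuous_iteratedFDeriv (by exact_mod_cast le_top)
  set R := eLpNorm f p₁ volume * eLpNorm (iteratedFDeriv ℝ m g) p₂ volume
          + eLpNorm (iteratedFDeriv ℝ m f) p₃ volume * eLpNorm g p₄ volume with hR
  calc eLpNorm (iteratedFDeriv ℝ m (fun x => f x * g x)) p volume
      ≤ eLpNorm (∑ i ∈ Finset.range (m + 1), (m.choose i : ℝ) •
          fun x => ‖iteratedFDeriv ℝ i f x‖ * ‖iteratedFDeriv ℝ (m - i) g x‖) p volume := by
        refine eLpNorm_mono_real fun x => ?_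
        rw [Finset.sum_apply]
        refine (norm_iteratedFDeriv_mul_le cf cg x (by exact_mod_cast le_top)).trans (le_of_eq ?_)
        refine Finset.sum_congr rfl fun i _ => ?_
        simp [mul_assoc]
    _ ≤ ∑ i ∈ Finset.range (m + 1), eLpNorm ((m.choose i : ℝ) •
          fun x => ‖iteratedFDeriv ℝ i f x‖ * ‖iteratedFDeriv ℝ (m - i) g x‖) p volume := by
        refine eLpNorm_sum_le (fun i _ => ?_) hp
        exact (((cont cf i).norm.mul (cont cg (m - i)).norm).const_smul _).aestronglyMeasurable
    _ ≤ ∑ i ∈ Finset.range (m + 1), ENNReal.ofReal ((m.choose i : ℝ) * K i) * R := by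
        refine Finset.sum_le_sum fun i hi => ?_
        rw [eLpNorm_const_smul, Real.enorm_eq_ofReal (by positivity),
          ENNReal.ofReal_mul (by positivity), mul_assoc]
        gcongr
        exact hKle i (by simpa [Nat.lt_succ_iff] using hi) f g cf sf cg sg
    _ = _ := by
        rw [← Finset.sum_mul, ENNReal.ofReal_sum_of_nonneg]
        intro i _
        have := hK i
        positivity
end
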